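/- arXiv:1908.01432 — 5 statements merged into one kernel-verified Lean document; each statement's English description precedes it below -/
import Mathlib

section
/- Let G be a graph and H an induced subgraph of G. Suppose g is a k-rainbow independent dominating function of H of minimum weight (a γ_rik(H)-function), and let V_0 denote the set of vertices of H assigned value 0 under g. Then there exists a k-rainbow independent dominating function f of G such that f(v) = g(v) for every vertex v of H and the weight of f is at most |V(G)| − |V_0|. -/
open scoped Classical

/-- A `k`-rainbow independent dominating function of `G`: values in `{0,...,k}`,
each nonzero colour class is independent, and every vertex of value `0` has,
for each `i ∈ {1,...,k}`, a neighbor of value `i`. -/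
def IsKRiDF {V : Type*} (G : SimpleGraph V) (k : ℕ) (f : V → ℕ) : Prop :=
  (∀ v, f v ≤ k) ∧
  (∀ i, 1 ≤ i → i ≤ k → ∀ u v, f u = i → f v = i → ¬ G.Adj u v) ∧
  (∀ v, f v = 0 → ∀ i, 1 ≤ i → i ≤ k → ∃ u, G.Adj v u ∧ f u = i)

/-- The weight of a labelling: the number of vertices with nonzero value. -/
noncomputable def riWeight {V : Type*} [Fintype V] (f : V → ℕ) : ℕ :=
  (Finset.univ.filter fun v => f v ≠ 0).card

/-- The `k`-rainbow independent domination number. -/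
noncomputable def riNumber {V : Type*} [Fintype V] (G : SimpleGraph V) (k : ℕ) : ℕ :=
  sInf {w | ∃ f, IsKRiDF G k f ∧ riWeight f = w}

/-- The star `S_m = K_{1,m}` on `Fin (m+1)` with centre `0`. -/
def starGraph (m : ℕ) : SimpleGraph (Fin (m + 1)) :=
  SimpleGraph.fromRel (fun a b => (a : ℕ) = 0 ∧ (b : ℕ) ≠ 0)

/-- The star `S_m` with one extra edge between the leaves `1` and `2`. -/
def starPlusGraph (m : ℕ) : SimpleGraph (Fin (m + 1)) :=
  SimpleGraph.fromRel (fun a b => ((a : ℕ) = 0 ∧ (b : ℕ) ≠ 0) ∨ ((a : ℕ) = 1 ∧ (b : ℕ) = 2))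

/-- The double star `S(n,m)`: centres `0` (with leaves `2,...,n+1`) and `1`
(with leaves `n+2,...,n+m+1`), joined by the bridge `01`. -/
def doubleStar (n m : ℕ) : SimpleGraph (Fin (n + m + 2)) :=
  SimpleGraph.fromRel (fun a b =>
    ((a : ℕ) = 0 ∧ (b : ℕ) = 1) ∨
    ((a : ℕ) = 0 ∧ 2 ≤ (b : ℕ) ∧ (b : ℕ) < n + 2) ∨
    ((a : ℕ) = 1 ∧ n + 2 ≤ (b : ℕ)))

/-- A kRiDF of `G[t]` extends to a kRiDF of `G[t ∪ {a}]`: give `a` a colour missing from its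
neighbourhood in `t` if there is one, and `0` otherwise. -/
theorem IsKRiDF.exists_update_insert {V : Type*} {G : SimpleGraph V} {k : ℕ} {t : Set V}
    {f : V → ℕ} (hf : IsKRiDF (G.induce t) k fun v => f v) {a : V} (ha : a ∉ t) :
    ∃ c, IsKRiDF (G.induce (insert a t)) k fun v => Function.update f a c v := by
  obtain ⟨hle, hind, hdom⟩ := hf
  have hne : ∀ v ∈ t, v ≠ a := fun v hv h => ha (h ▸ hv)
  by_cases h : ∀ i, 1 ≤ i → i ≤ k → ∃ u ∈ t, G.Adj a u ∧ f u = i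
  · refine ⟨0, ?_, ?_, ?_⟩
    · rintro ⟨v, rfl | hv⟩
      · simp
      · simpa [hne v hv] using hle ⟨v, hv⟩
    · rintro i hi hik ⟨u, rfl | hu⟩ ⟨v, rfl | hv⟩ hfu hfv
      · simp
      · simp at hfu; omega
      · simp at hfv; omega
      · simp only [Function.update_of_ne (hne u hu)] at hfu
        simp only [Function.update_of_ne (hne v hv)] at hfv
        exact hind i hi hik ⟨u, hu⟩ ⟨v, hv⟩ hfu hfv
    · rintro ⟨v, rfl | hv⟩ hfv i hi hik
      · obtain ⟨u, hu, hadj, hfu⟩ := h i hi hik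
        exact ⟨⟨u, Or.inr hu⟩, hadj, by simpa [hne u hu] using hfu⟩
      · simp only [Function.update_of_ne (hne v hv)] at hfv
        obtain ⟨⟨u, hu⟩, hadj, hfu⟩ := hdom ⟨v, hv⟩ hfv i hi hik
        exact ⟨⟨u, Or.inr hu⟩, hadj, by simpa [hne u hu] using hfu⟩
  · push Not at h
    obtain ⟨c, hc, hck, hmiss⟩ := h
    refine ⟨c, ?_, ?_, ?_⟩
    · rintro ⟨v, rfl | hv⟩
      · simpa using hck
      · simpa [hne v hv] using hle ⟨v, hv⟩
    · rintro i hi hik ⟨u, rfl | hu⟩ ⟨v, rfl | hv⟩ hfu hfv hadj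
      · simp at hadj
      · simp only [Function.update_self] at hfu
        simp only [Function.update_of_ne (hne v hv)] at hfv
        exact hmiss v hv hadj (hfv.trans hfu.symm)
      · simp only [Function.update_self] at hfv
        simp only [Function.update_of_ne (hne u hu)] at hfu
        exact hmiss u hu hadj.symm (hfu.trans hfv.symm)
      · simp only [Function.update_of_ne (hne u hu)] at hfu
        simp only [Function.update_of_ne (hne v hv)] at hfv
        exact hind i hi hik ⟨u, hu⟩ ⟨v, hv⟩ hfu hfv hadj
    · rintro ⟨v, rfl | hv⟩ hfv i hi hik
      · simp at hfv; omega
      · simp only [Function.update_of_ne (hne v hv)] at hfv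
        obtain ⟨⟨u, hu⟩, hadj, hfu⟩ := hdom ⟨v, hv⟩ hfv i hi hik
        exact ⟨⟨u, Or.inr hu⟩, hadj, by simpa [hne u hu] using hfu⟩

/-- Every kRiDF of an induced subgraph of a finite graph extends to a kRiDF of the graph. -/
theorem IsKRiDF.exists_extension {V : Type*} [Finite V] {G : SimpleGraph V} {k : ℕ} {s : Set V}
    {g : s → ℕ} (hg : IsKRiDF (G.induce s) k g) :
    ∃ f : V → ℕ, IsKRiDF G k f ∧ ∀ v : s, f v = g v := by
  have key : ∀ r : Set V, ∃ f : V → ℕ,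
      IsKRiDF (G.induce (r ∪ s)) k (fun v => f v) ∧ ∀ v : s, f v = g v := by
    intro r
    induction r, r.toFinite using Set.Finite.induction_on with
    | empty =>
      have hres : ∀ v : s, (fun v => if h : v ∈ s then g ⟨v, h⟩ else 0) (v : V) = g v := by simp
      refine ⟨fun v => if h : v ∈ s then g ⟨v, h⟩ else 0, ?_, hres⟩
      rw [Set.empty_union]
      simpa using hg
    | @insert a r _ _ ih =>
      obtain ⟨f, hf, hfg⟩ := ih
      rw [Set.insert_union]
      by_cases ha : a ∈ r ∪ s
      · rw [Set.insert_eq_of_mem ha]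
        exact ⟨f, hf, hfg⟩
      · obtain ⟨c, hc⟩ := hf.exists_update_insert ha
        refine ⟨_, hc, fun v => ?_⟩
        have hva : (v : V) ≠ a := fun h => ha (h ▸ Or.inr v.2)
        rw [Function.update_of_ne hva, hfg]
  obtain ⟨f, hf, hfg⟩ := key Set.univ
  rw [Set.univ_union] at hf
  obtain ⟨hle, hind, hdom⟩ := hf
  refine ⟨f, ⟨fun v => hle ⟨v, trivial⟩, fun i hi hik u v hu hv => ?_, fun v hv i hi hik => ?_⟩, hfg⟩
  · exact hind i hi hik ⟨u, trivial⟩ ⟨v, trivial⟩ hu hv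
  · obtain ⟨u, hadj, hu⟩ := hdom ⟨v, trivial⟩ hv i hi hik
    exact ⟨u, hadj, hu⟩

/-- a minimum-weight kRiDF of an induced subgraph extends to a kRiDF
of the whole graph of weight at most `|V(G)| - |V₀|`. -/
theorem stmt_0 {V : Type*} [Fintype V] (G : SimpleGraph V) (k : ℕ)
    (s : Set V) (g : ↥s → ℕ)
    (hg : IsKRiDF (G.induce s) k g)
    (hmin : riWeight g = riNumber (G.induce s) k) :
    ∃ f : V → ℕ, IsKRiDF G k f ∧ (∀ v : ↥s, f ↑v = g v) ∧
      riWeight f ≤ Fintype.card V - (Finset.univ.filter fun v : ↥s => g v = 0).card := by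
  obtain ⟨f, hf, hfg⟩ := hg.exists_extension
  refine ⟨f, hf, hfg, ?_⟩
  have hzero : (Finset.univ.filter fun v : ↥s => g v = 0).card ≤
      (Finset.univ.filter fun v => f v = 0).card :=
    Finset.card_le_card_of_injOn Subtype.val
      (fun v hv => by simpa [hfg] using hv) Subtype.val_injective.injOn
  have hsplit : (Finset.univ.filter fun v => f v = 0).card + riWeight f = Fintype.card V := by
    rw [riWeight, ← Finset.card_univ]
    convert Finset.card_filter_add_card_filter_not (s := Finset.univ) (fun v => f v = 0)
  omega
end

section
/- Let G be a connected graph of order n ≥ 3. Then γ_ri2(G) = n − 1 if and only if G is isomorphic to one of the following graphs: the star S_{n−1}, the graph S_{n−1}^+, the double star S(n−3,1) (with n ≥ 4), or the 5-cycle C_5. -/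
open scoped Classical

/-- Two distinct vertices, each adjacent to both of two disjoint independent sets. -/
def HasRainbowPair {V : Type*} (G : SimpleGraph V) : Prop :=
  ∃ u w a b a' b', u ≠ w ∧ G.Adj u a ∧ G.Adj u b ∧ G.Adj w a' ∧ G.Adj w b' ∧
    ¬ G.Adj a a' ∧ ¬ G.Adj b b' ∧ a ≠ b ∧ a ≠ b' ∧ a' ≠ b ∧ a' ≠ b'

/-- Disjoint independent sets extend to the colour classes of a `2`-rainbow independent
dominating function. -/
theorem exists_isKRiDF_two_extending {V : Type*} [Finite V] (G : SimpleGraph V) (A B : Set V)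
    (hAB : Disjoint A B) (hA : ∀ u ∈ A, ∀ v ∈ A, ¬ G.Adj u v)
    (hB : ∀ u ∈ B, ∀ v ∈ B, ¬ G.Adj u v) :
    ∃ f, IsKRiDF G 2 f ∧ (∀ v ∈ A, f v = 1) ∧ ∀ v ∈ B, f v = 2 := by
  let P : Set (Set V × Set V) := {p | Disjoint p.1 p.2 ∧
    (∀ u ∈ p.1, ∀ v ∈ p.1, ¬ G.Adj u v) ∧ ∀ u ∈ p.2, ∀ v ∈ p.2, ¬ G.Adj u v}
  obtain ⟨⟨C, D⟩, hle, hmem, hmax⟩ :=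
    (Set.toFinite P).exists_le_maximal (a := (A, B)) ⟨hAB, hA, hB⟩
  obtain ⟨hCD, hC, hD⟩ := hmem
  simp only at hCD hC hD
  have hdisj : ∀ v, v ∈ C → v ∉ D := fun v h1 h2 => Set.disjoint_left.mp hCD h1 h2
  refine ⟨fun v => if v ∈ C then 1 else if v ∈ D then 2 else 0, ⟨?_, ?_, ?_⟩, ?_, ?_⟩
  · intro v
    dsimp only
    split_ifs <;> omega
  · intro i hi1 hi2 u v hu hv
    dsimp only at hu hv
    have : i = 1 ∨ i = 2 := by omega
    rcases this with rfl | rfl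
    · exact hC u (by grind) v (by grind)
    · exact hD u (by grind) v (by grind)
  · intro v hv i hi1 hi2
    have hvC : v ∉ C := by grind
    have hvD : v ∉ D := by grind
    have : i = 1 ∨ i = 2 := by omega
    rcases this with rfl | rfl
    · by_contra! hcon
      have hno : ∀ u ∈ C, ¬ G.Adj v u := fun u hu huv => hcon u huv (by simp [hu])
      have hin : (insert v C, D) ∈ P := by
        refine ⟨?_, ?_, hD⟩
        · rw [Set.disjoint_left]; grind
        · rintro x (rfl | hx) y (rfl | hy)
          · exact G.loopless.irrefl _
          · exact hno y hy
          · exact fun h => hno x hx h.symm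
          · exact hC x hx y hy
      exact hvC ((hmax hin ⟨Set.subset_insert v C, le_rfl⟩).1 (Set.mem_insert v C))
    · by_contra! hcon
      have hno : ∀ u ∈ D, ¬ G.Adj v u := fun u hu huv =>
        by
        have hC' : u ∉ C := fun h => hdisj u h hu
        exact hcon u huv (by simp [hu, hC'])
      have hin : (C, insert v D) ∈ P := by
        refine ⟨?_, hC, ?_⟩
        · rw [Set.disjoint_left]; grind
        · rintro x (rfl | hx) y (rfl | hy)
          · exact G.loopless.irrefl _
          · exact hno y hy
          · exact fun h => hno x hx h.symm
          · exact hD x hx y hy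
      exact hvD ((hmax hin ⟨le_rfl, Set.subset_insert v D⟩).2 (Set.mem_insert v D))
  · intro v hv
    simp [hle.1 hv]
  · intro v hv
    have h2 : v ∈ D := hle.2 hv
    have h1 : v ∉ C := fun h => hdisj v h h2
    simp [h1, h2]

theorem IsKRiDF.eq_zero_of_adj {V : Type*} {G : SimpleGraph V} {f : V → ℕ}
    (hf : IsKRiDF G 2 f) {u a b : V} (hua : G.Adj u a) (hub : G.Adj u b)
    (ha : f a = 1) (hb : f b = 2) : f u = 0 := by
  have h := hf.1 u
  have h1 : f u ≠ 1 := fun h => hf.2.1 1 le_rfl (by norm_num) u a h ha hua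
  have h2 : f u ≠ 2 := fun h => hf.2.1 2 (by norm_num) le_rfl u b h hb hub
  omega

theorem card_zeros_add_riWeight {V : Type*} [Fintype V] (f : V → ℕ) :
    (Finset.univ.filter fun v => f v = 0).card + riWeight f = Fintype.card V :=
  Finset.card_filter_add_card_filter_not _

theorem IsKRiDF.riNumber_le {V : Type*} [Fintype V] {G : SimpleGraph V} {k : ℕ} {f : V → ℕ}
    (hf : IsKRiDF G k f) : riNumber G k ≤ riWeight f :=
  Nat.sInf_le ⟨f, hf, rfl⟩

theorem HasRainbowPair.riNumber_add_two_le {V : Type*} [Fintype V] {G : SimpleGraph V}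
    (h : HasRainbowPair G) : riNumber G 2 + 2 ≤ Fintype.card V := by
  obtain ⟨u, w, a, b, a', b', huw, hua, hub, hwa, hwb, haa, hbb, h1, h2, h3, h4⟩ := h
  obtain ⟨f, hf, hA, hB⟩ := exists_isKRiDF_two_extending G {a, a'} {b, b'}
    (by simp [h1.symm, h2.symm, h3.symm, h4.symm])
    (by simp [haa, G.adj_comm a' a]) (by simp [hbb, G.adj_comm b' b])
  have hu : f u = 0 := hf.eq_zero_of_adj hua hub (hA _ (by simp)) (hB _ (by simp))
  have hw : f w = 0 := hf.eq_zero_of_adj hwa hwb (hA _ (by simp)) (hB _ (by simp))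
  have : 1 < (Finset.univ.filter fun v => f v = 0).card :=
    Finset.one_lt_card.mpr ⟨u, by simpa, w, by simpa, huw⟩
  have := card_zeros_add_riWeight f
  have := hf.riNumber_le
  omega

theorem IsKRiDF.hasRainbowPair {V : Type*} [Fintype V] {G : SimpleGraph V} {f : V → ℕ}
    (hf : IsKRiDF G 2 f) (hw : riWeight f + 2 ≤ Fintype.card V) : HasRainbowPair G := by
  have := card_zeros_add_riWeight f
  obtain ⟨u, hu, w, hw, huw⟩ := Finset.one_lt_card.mp
    (show 1 < (Finset.univ.filter fun v => f v = 0).card by omega)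
  simp only [Finset.mem_filter, Finset.mem_univ, true_and] at hu hw
  obtain ⟨a, hua, ha⟩ := hf.2.2 u hu 1 le_rfl (by norm_num)
  obtain ⟨b, hub, hb⟩ := hf.2.2 u hu 2 (by norm_num) le_rfl
  obtain ⟨a', hwa, ha'⟩ := hf.2.2 w hw 1 le_rfl (by norm_num)
  obtain ⟨b', hwb, hb'⟩ := hf.2.2 w hw 2 (by norm_num) le_rfl
  refine ⟨u, w, a, b, a', b', huw, hua, hub, hwa, hwb,
    hf.2.1 1 le_rfl (by norm_num) _ _ ha ha', hf.2.1 2 (by norm_num) le_rfl _ _ hb hb', ?_⟩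
  refine ⟨?_, ?_, ?_, ?_⟩ <;> rintro rfl <;> omega

theorem HasRainbowPair.of_iso {V W : Type*} {G : SimpleGraph V} {H : SimpleGraph W} (e : G ≃g H)
    (h : HasRainbowPair G) : HasRainbowPair H := by
  obtain ⟨u, w, a, b, a', b', h⟩ := h
  exact ⟨e u, e w, e a, e b, e a', e b', by simpa [e.map_adj_iff] using h⟩

/-- A nonempty set of vertices closed under adjacency is everything. -/
theorem SimpleGraph.Connected.mem_of_adj_closed {V : Type*} {G : SimpleGraph V}
    (hG : G.Connected) (p : V → Prop) {x : V} (hx : p x) (h : ∀ u v, p u → G.Adj u v → p v)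
    (v : V) : p v := by
  obtain ⟨q⟩ := hG.preconnected x v
  induction q with
  | nil => exact hx
  | cons hadj _ ih => exact ih (h _ _ hx hadj)

theorem SimpleGraph.Connected.exists_two_neighbors {V : Type*} [Fintype V] {G : SimpleGraph V}
    (hG : G.Connected) (hn : 3 ≤ Fintype.card V) :
    ∃ u a b, G.Adj u a ∧ G.Adj u b ∧ a ≠ b := by
  by_contra! hcon
  obtain ⟨x⟩ := hG.nonempty
  have hy : ∃ y, G.Adj x y := by
    by_contra! hno
    have := hG.mem_of_adj_closed (fun v => v = x) rfl (by rintro _ v rfl h; exact absurd h (hno v))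
    have : Fintype.card V ≤ 1 :=
      Fintype.card_le_one_iff.mpr fun a b => (this a).trans (this b).symm
    omega
  obtain ⟨y, hxy⟩ := hy
  have hall := hG.mem_of_adj_closed (fun v => v = x ∨ v = y) (Or.inl rfl) (by
    rintro _ v (rfl | rfl) h
    · exact Or.inr (hcon _ _ _ h hxy)
    · exact Or.inl (hcon _ _ _ h hxy.symm))
  have : Fintype.card V ≤ 2 := by
    rw [← Finset.card_univ]
    exact (Finset.card_le_card fun v _ => by simpa using hall v).trans (Finset.card_le_two (a := x) (b := y))
  omega

theorem SimpleGraph.Connected.riNumber_two_eq_iff {V : Type*} [Fintype V] {G : SimpleGraph V}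
    (hG : G.Connected) (hn : 3 ≤ Fintype.card V) :
    riNumber G 2 = Fintype.card V - 1 ↔ ¬ HasRainbowPair G := by
  constructor
  · intro h hp
    have := hp.riNumber_add_two_le
    omega
  · intro hp
    obtain ⟨u, a, b, hua, hub, hab⟩ := hG.exists_two_neighbors hn
    obtain ⟨f, hf, hA, hB⟩ := exists_isKRiDF_two_extending G {a} {b}
      (by simpa using hab) (by simp) (by simp)
    have hu : f u = 0 := hf.eq_zero_of_adj hua hub (hA _ rfl) (hB _ rfl)
    have : 0 < (Finset.univ.filter fun v => f v = 0).card :=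
      Finset.card_pos.mpr ⟨u, by simpa⟩
    have := card_zeros_add_riWeight f
    have := hf.riNumber_le
    obtain ⟨g, hg, hgw⟩ : riNumber G 2 ∈ {w | ∃ f, IsKRiDF G 2 f ∧ riWeight f = w} :=
      Nat.sInf_mem ⟨_, f, hf, rfl⟩
    have : ¬ (riWeight g + 2 ≤ Fintype.card V) := fun h => hp (hg.hasRainbowPair h)
    omega

theorem not_hasRainbowPair_starGraph (m : ℕ) : ¬ HasRainbowPair (starGraph m) := by
  rintro ⟨u, w, a, b, a', b', h⟩
  simp only [starGraph, SimpleGraph.fromRel_adj, ne_eq, Fin.ext_iff] at h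
  omega

theorem not_hasRainbowPair_starPlusGraph (m : ℕ) : ¬ HasRainbowPair (starPlusGraph m) := by
  have key {u a b : Fin (m + 1)} (hua : (starPlusGraph m).Adj u a)
      (hub : (starPlusGraph m).Adj u b) (hab : a ≠ b) :
      ((u : ℕ) = 0 ∧ (a : ℕ) ≠ 0 ∧ (b : ℕ) ≠ 0) ∨
      ((u : ℕ) = 1 ∧ ((a : ℕ) = 0 ∧ (b : ℕ) = 2 ∨ (a : ℕ) = 2 ∧ (b : ℕ) = 0)) ∨
      ((u : ℕ) = 2 ∧ ((a : ℕ) = 0 ∧ (b : ℕ) = 1 ∨ (a : ℕ) = 1 ∧ (b : ℕ) = 0)) := by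
    simp only [starPlusGraph, SimpleGraph.fromRel_adj, ne_eq, Fin.ext_iff] at hua hub hab
    omega
  rintro ⟨u, w, a, b, a', b', huw, hua, hub, hwa, hwb, haa, hbb, h1, h2, h3, h4⟩
  have hu := key hua hub h1
  have hw := key hwa hwb h4
  clear hua hub hwa hwb h1 h2 h3 h4
  simp only [starPlusGraph, SimpleGraph.fromRel_adj, ne_eq, Fin.ext_iff] at huw haa hbb
  omega

theorem not_hasRainbowPair_doubleStar_one (m : ℕ) : ¬ HasRainbowPair (doubleStar m 1) := by
  have key {u a : Fin (m + 1 + 2)} (hua : (doubleStar m 1).Adj u a) :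
      ((u : ℕ) = 0 ∧ (a : ℕ) ≠ 0 ∧ (a : ℕ) < m + 2) ∨
      ((u : ℕ) = 1 ∧ ((a : ℕ) = 0 ∨ (a : ℕ) = m + 2)) ∨
      ((u : ℕ) = m + 2 ∧ (a : ℕ) = 1) ∨ (2 ≤ (u : ℕ) ∧ (u : ℕ) < m + 2 ∧ (a : ℕ) = 0) := by
    simp only [doubleStar, SimpleGraph.fromRel_adj, ne_eq, Fin.ext_iff] at hua
    omega
  have key₂ {u a b : Fin (m + 1 + 2)} (hua : (doubleStar m 1).Adj u a)
      (hub : (doubleStar m 1).Adj u b) (hab : a ≠ b) :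
      ((u : ℕ) = 0 ∧ (a : ℕ) ≠ 0 ∧ (a : ℕ) < m + 2 ∧ (b : ℕ) ≠ 0 ∧ (b : ℕ) < m + 2) ∨
      ((u : ℕ) = 1 ∧ ((a : ℕ) = 0 ∨ (b : ℕ) = 0)) := by
    have ha := key hua
    have hb := key hub
    rw [ne_eq, Fin.ext_iff] at hab
    clear hua hub
    rcases ha with ha | ha | ha | ha <;> omega
  have adj_zero {u a : Fin (m + 1 + 2)} (hu : (u : ℕ) = 0) (h0 : (a : ℕ) ≠ 0)
      (h : (a : ℕ) < m + 2) : (doubleStar m 1).Adj u a := by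
    simp only [doubleStar, SimpleGraph.fromRel_adj, ne_eq, Fin.ext_iff]
    omega
  rintro ⟨u, w, a, b, a', b', huw, hua, hub, hwa, hwb, haa, hbb, h1, h2, h3, h4⟩
  rw [ne_eq, Fin.ext_iff] at huw
  rcases key₂ hua hub h1 with ⟨hu, ha, ha', hb, hb'⟩ | ⟨hu, h⟩ <;>
    rcases key₂ hwa hwb h4 with ⟨hw, hc, hc', hd, hd'⟩ | ⟨hw, h'⟩
  · omega
  · rcases h' with h' | h'
    · exact haa (adj_zero h' ha ha').symm
    · exact hbb (adj_zero h' hb hb').symm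
  · rcases h with h | h
    · exact haa (adj_zero h hc hc')
    · exact hbb (adj_zero h hd hd')
  · omega

theorem not_hasRainbowPair_cycleGraph_five : ¬ HasRainbowPair (SimpleGraph.cycleGraph 5) := by
  have key : ∀ u a, (SimpleGraph.cycleGraph 5).Adj u a → ∀ b, (SimpleGraph.cycleGraph 5).Adj u b →
      a ≠ b → ∀ w, u ≠ w → ∀ a', (SimpleGraph.cycleGraph 5).Adj w a' →
      ¬ (SimpleGraph.cycleGraph 5).Adj a a' → a' ≠ b →
      ∀ b', (SimpleGraph.cycleGraph 5).Adj w b' → ¬ (SimpleGraph.cycleGraph 5).Adj b b' →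
      a ≠ b' → a' = b' := by
    simp only [SimpleGraph.cycleGraph_adj]
    decide
  rintro ⟨u, w, a, b, a', b', huw, hua, hub, hwa, hwb, haa, hbb, h1, h2, h3, h4⟩
  exact h4 (key u a hua b hub h1 w huw a' hwa haa h3 b' hwb hbb h2)

theorem exists_equiv_apply_eq {ι V W : Type*} [Fintype V] [Fintype W]
    (h : Fintype.card V = Fintype.card W) (f : ι → V) (g : ι → W)
    (hf : Function.Injective f) (hg : Function.Injective g) :
    ∃ e : V ≃ W, ∀ i, e (f i) = g i := by
  let e₀ := Fintype.equivOfCardEq h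
  let e₁ := ((Equiv.ofInjective (e₀ ∘ f) (e₀.injective.comp hf)).symm.trans
    (Equiv.ofInjective g hg))
  refine ⟨e₀.trans e₁.extendSubtype, fun i => ?_⟩
  have hi : e₀ (f i) ∈ Set.range (e₀ ∘ f) := ⟨i, rfl⟩
  have hinv : (Equiv.ofInjective (e₀ ∘ f) (e₀.injective.comp hf)).symm ⟨e₀ (f i), hi⟩ = i :=
    Equiv.ofInjective_symm_apply (e₀.injective.comp hf) i
  rw [Equiv.trans_apply, Equiv.extendSubtype_apply_of_mem _ _ hi]
  simp [e₁, hinv]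

theorem nonempty_iso_starGraph {V : Type*} [Fintype V] {G : SimpleGraph V} {m : ℕ}
    (hm : Fintype.card V = m + 1) {x : V} (hadj : ∀ u v, G.Adj u v ↔ u ≠ v ∧ (u = x ∨ v = x)) :
    Nonempty (G ≃g starGraph m) := by
  obtain ⟨e, he⟩ := exists_equiv_apply_eq (W := Fin (m + 1)) (by simpa using hm) ![x] ![0]
    (Function.injective_of_subsingleton _) (Function.injective_of_subsingleton _)
  have h0 : e x = 0 := he 0
  have hx (u : V) : u = x ↔ ((e u : Fin (m + 1)) : ℕ) = 0 := by
    rw [← e.injective.eq_iff, h0, Fin.ext_iff, Fin.val_zero]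
  refine ⟨⟨e, fun {u v} => ?_⟩⟩
  rw [hadj, hx, hx, ← e.injective.ne_iff]
  simp only [starGraph, SimpleGraph.fromRel_adj, ne_eq, Fin.ext_iff]
  omega

theorem nonempty_iso_starPlusGraph {V : Type*} [Fintype V] {G : SimpleGraph V} {m : ℕ}
    (hm : Fintype.card V = m + 1) {x y z : V} (hxy : x ≠ y) (hxz : x ≠ z) (hyz : y ≠ z)
    (hadj : ∀ u v, G.Adj u v ↔
      u ≠ v ∧ (u = x ∨ v = x ∨ (u = y ∧ v = z) ∨ (u = z ∧ v = y))) :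
    Nonempty (G ≃g starPlusGraph m) := by
  have h3 : ({x, y, z} : Finset V).card ≤ Fintype.card V := Finset.card_le_univ _
  rw [Finset.card_eq_three.mpr ⟨x, y, z, hxy, hxz, hyz, rfl⟩] at h3
  obtain ⟨e, he⟩ := exists_equiv_apply_eq (W := Fin (m + 1)) (by simpa using hm) ![x, y, z]
    ![⟨0, by omega⟩, ⟨1, by omega⟩, ⟨2, by omega⟩]
    (by simp [Function.Injective, Fin.forall_fin_succ, hxy, hxz, hyz, hxy.symm, hxz.symm, hyz.symm])
    (by simp [Function.Injective, Fin.forall_fin_succ])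
  have hval (p : V) (i : Fin (m + 1)) (h : e p = i) (u : V) :
      u = p ↔ ((e u : Fin (m + 1)) : ℕ) = i := by
    rw [← e.injective.eq_iff, h, Fin.ext_iff]
  have hx := hval x _ (he 0)
  have hy := hval y _ (he 1)
  have hz := hval z _ (he 2)
  refine ⟨⟨e, fun {u v} => ?_⟩⟩
  rw [hadj, hx, hx, hy, hz, hy, hz, ← e.injective.ne_iff]
  simp only [starPlusGraph, SimpleGraph.fromRel_adj, ne_eq, Fin.ext_iff, Matrix.cons_val]
  omega

theorem nonempty_iso_doubleStar_one {V : Type*} [Fintype V] {G : SimpleGraph V} {m : ℕ}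
    (hm : Fintype.card V = m + 3) {b c d : V} (hbc : b ≠ c) (hbd : b ≠ d) (hcd : c ≠ d)
    (hadj : ∀ u v, G.Adj u v ↔
      u ≠ v ∧ ((u = b ∧ v ≠ d) ∨ (v = b ∧ u ≠ d) ∨ (u = c ∧ v = d) ∨ (u = d ∧ v = c))) :
    Nonempty (G ≃g doubleStar m 1) := by
  obtain ⟨e, he⟩ := exists_equiv_apply_eq (W := Fin (m + 1 + 2)) (by simpa using hm) ![b, c, d]
    ![⟨0, by omega⟩, ⟨1, by omega⟩, ⟨m + 2, by omega⟩]
    (by simp [Function.Injective, Fin.forall_fin_succ, hbc, hbd, hcd, hbc.symm, hbd.symm, hcd.symm])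
    (by simp [Function.Injective, Fin.forall_fin_succ])
  have hval (p : V) (i : Fin (m + 1 + 2)) (h : e p = i) (u : V) :
      u = p ↔ ((e u : Fin (m + 1 + 2)) : ℕ) = i := by
    rw [← e.injective.eq_iff, h, Fin.ext_iff]
  have hb := hval b _ (he 0)
  have hc := hval c _ (he 1)
  have hd := hval d _ (he 2)
  refine ⟨⟨e, fun {u v} => ?_⟩⟩
  have hu := (e u).isLt
  have hv := (e v).isLt
  rw [hadj, ne_eq v d, ne_eq u d, hb, hb, hc, hc, hd, hd, ← e.injective.ne_iff]
  simp only [doubleStar, SimpleGraph.fromRel_adj, ne_eq, Fin.ext_iff, Matrix.cons_val]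
  omega

section Classification

variable {V : Type*} {G : SimpleGraph V}

theorem not_adj_of_not_hasRainbowPair (hp : ¬ HasRainbowPair G) {u w a b : V} (huw : u ≠ w)
    (hab : a ≠ b) (hua : G.Adj u a) (hub : G.Adj u b) (hwa : G.Adj w a) : ¬ G.Adj w b :=
  fun hwb => hp ⟨u, w, a, b, a, b, huw, hua, hub, hwa, hwb, G.loopless.irrefl _,
    G.loopless.irrefl _, hab, hab, hab, hab⟩

theorem adj_ends_of_not_hasRainbowPair (hp : ¬ HasRainbowPair G) {p q r s t : V}
    (hpq : G.Adj p q) (hqr : G.Adj q r) (hrs : G.Adj r s) (hst : G.Adj s t)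
    (hqs : q ≠ s) (hpr : p ≠ r) (hrt : r ≠ t) : G.Adj p t := by
  by_contra hpt
  exact hp ⟨q, s, r, p, r, t, hqs, hqr, hpq.symm, hrs.symm, hst, G.loopless.irrefl _, hpt,
    hpr.symm, hrt, hpr.symm, hrt⟩

theorem mem_of_adj_five_cycle (hp : ¬ HasRainbowPair G) {p q r s t v : V}
    (hpq : G.Adj p q) (hqr : G.Adj q r) (hrs : G.Adj r s) (hst : G.Adj s t) (htp : G.Adj t p)
    (hnd : [p, q, r, s, t].Nodup) (hv : G.Adj p v) : v ∈ [p, q, r, s, t] := by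
  by_contra hmem
  simp only [List.nodup_cons, List.mem_cons, List.not_mem_nil, not_or, or_false,
    List.nodup_nil, and_true] at hnd hmem
  have hvs : G.Adj v s := adj_ends_of_not_hasRainbowPair hp hv.symm hpq hqr hrs (by tauto)
    (by tauto) (by tauto)
  exact not_adj_of_not_hasRainbowPair hp (u := t) (w := v) (a := p) (b := s)
    (fun h => by simp_all) (by tauto) htp hst.symm hv.symm hvs

theorem SimpleGraph.Connected.nonempty_iso_cycleGraph_five (hG : G.Connected)
    (hp : ¬ HasRainbowPair G) {p q r s t : V} (hpq : G.Adj p q) (hqr : G.Adj q r)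
    (hrs : G.Adj r s) (hst : G.Adj s t) (hnd : [p, q, r, s, t].Nodup) :
    Nonempty (G ≃g SimpleGraph.cycleGraph 5) := by
  have hall := hnd
  simp only [List.nodup_cons, List.mem_cons, List.not_mem_nil, not_or, or_false,
    List.nodup_nil, and_true] at hnd
  have htp : G.Adj t p :=
    (adj_ends_of_not_hasRainbowPair hp hpq hqr hrs hst (by tauto) (by tauto) (by tauto)).symm
  have hcover := hG.mem_of_adj_closed (fun v => v ∈ [p, q, r, s, t]) (x := p) (by simp) (by
    intro u v hu huv
    simp only [List.mem_cons, List.not_mem_nil, or_false] at hu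
    rcases hu with rfl | rfl | rfl | rfl | rfl
    · exact mem_of_adj_five_cycle hp hpq hqr hrs hst htp hall huv
    · have := mem_of_adj_five_cycle hp hqr hrs hst htp hpq (by grind) huv
      grind
    · have := mem_of_adj_five_cycle hp hrs hst htp hpq hqr (by grind) huv
      grind
    · have := mem_of_adj_five_cycle hp hst htp hpq hqr hrs (by grind) huv
      grind
    · have := mem_of_adj_five_cycle hp htp hpq hqr hrs hst (by grind) huv
      grind)
  have chord {x y z w v : V} (h1 : G.Adj x y) (h2 : G.Adj y z) (h3 : G.Adj z w) (h4 : G.Adj w v)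
      (h5 : G.Adj v x) (h : x ≠ w) (h' : z ≠ v) : ¬ G.Adj x z := fun hxz =>
    not_adj_of_not_hasRainbowPair hp h h' hxz h5.symm h3.symm h4
  have c1 : ¬ G.Adj p r := chord hpq hqr hrs hst htp (by tauto) (by tauto)
  have c2 : ¬ G.Adj q s := chord hqr hrs hst htp hpq (by tauto) (by grind)
  have c3 : ¬ G.Adj r t := chord hrs hst htp hpq hqr (by grind) (by grind)
  have c4 : ¬ G.Adj s p := chord hst htp hpq hqr hrs (by grind) (by grind)
  have c5 : ¬ G.Adj t q := chord htp hpq hqr hrs hst (by grind) (by grind)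
  have hbij : Function.Bijective ![p, q, r, s, t] := by
    constructor
    · rw [← List.nodup_ofFn]
      simpa [List.ofFn_succ] using hall
    · intro v
      have := hcover v
      simp only [List.mem_cons, List.not_mem_nil, or_false] at this
      rcases this with rfl | rfl | rfl | rfl | rfl
      exacts [⟨0, rfl⟩, ⟨1, rfl⟩, ⟨2, rfl⟩, ⟨3, rfl⟩, ⟨4, rfl⟩]
  refine ⟨(RelIso.mk (Equiv.ofBijective _ hbij) fun {i j} => ?_ :
    SimpleGraph.cycleGraph 5 ≃g G).symm⟩
  have := hpq.symm; have := hqr.symm; have := hrs.symm; have := hst.symm; have := htp.symm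
  have d1 : ¬ G.Adj r p := fun h => c1 h.symm
  have d2 : ¬ G.Adj s q := fun h => c2 h.symm
  have d3 : ¬ G.Adj t r := fun h => c3 h.symm
  have d4 : ¬ G.Adj p s := fun h => c4 h.symm
  have d5 : ¬ G.Adj q t := fun h => c5 h.symm
  fin_cases i <;> fin_cases j <;>
    simp [SimpleGraph.cycleGraph_adj', *] <;> decide

theorem SimpleGraph.Connected.nonempty_iso_starPlusGraph_of_triangle [Fintype V]
    (hG : G.Connected) {m : ℕ} (hm : Fintype.card V = m + 1)
    (h5 : ∀ p q r s t, G.Adj p q → G.Adj q r → G.Adj r s → G.Adj s t →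
      p ≠ r → p ≠ s → p ≠ t → q ≠ s → q ≠ t → r = t)
    {x y z : V} (hxy : G.Adj x y) (hxz : G.Adj x z) (hyz : G.Adj y z)
    (hy : ∀ v, G.Adj y v → v = x ∨ v = z) (hz : ∀ v, G.Adj z v → v = x ∨ v = y) :
    Nonempty (G ≃g starPlusGraph m) := by
  have n1 := hxy.ne
  have n2 := hxz.ne
  have n3 := hyz.ne
  have hcover := hG.mem_of_adj_closed (fun v => v = x ∨ G.Adj x v) (x := x) (Or.inl rfl) (by
    rintro u v (rfl | hxu) huv
    · exact Or.inr huv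
    · by_contra hcon
      have := hxu.ne
      have := huv.ne
      have := h5 v u x y z huv.symm hxu.symm hxy hyz
      clear h5 hG
      grind +splitImp [G.adj_comm])
  refine nonempty_iso_starPlusGraph hm n1 n2 n3 fun u v => ⟨fun huv => ⟨huv.ne, ?_⟩, ?_⟩
  · by_contra hcon
    have := huv.ne
    have := huv.symm
    have := hcover v
    have hu := hcover u
    have := h5 u v x y z huv
    clear h5 hG hcover
    grind +splitImp [G.adj_comm]
  · have := hcover u
    have := hcover v
    clear hcover
    grind +splitImp [G.adj_comm]

theorem SimpleGraph.Connected.nonempty_iso_starPlusGraph [Fintype V]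
    (hG : G.Connected) (hp : ¬ HasRainbowPair G) {m : ℕ} (hm : Fintype.card V = m + 1)
    (h5 : ∀ p q r s t, G.Adj p q → G.Adj q r → G.Adj r s → G.Adj s t →
      p ≠ r → p ≠ s → p ≠ t → q ≠ s → q ≠ t → r = t)
    {x y z : V} (hxy : G.Adj x y) (hxz : G.Adj x z) (hyz : G.Adj y z) :
    Nonempty (G ≃g starPlusGraph m) := by
  have key {x y z v v' : V} (hxy : G.Adj x y) (hxz : G.Adj x z) (hyz : G.Adj y z)
      (hv : G.Adj x v) (hvy : v ≠ y) (hvz : v ≠ z) (hv' : G.Adj y v') : v' = x ∨ v' = z := by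
    by_contra! hcon
    have := not_adj_of_not_hasRainbowPair hp (u := v) (w := z) (a := x) (b := y) hvz hxy.ne hv.symm
    have := h5 v x z y v' hv.symm hxz hyz.symm hv'
    clear h5 hG
    have := hv.ne
    have := hv'.ne
    have := hxy.ne
    have := hxz.ne
    have := hyz.ne
    grind +splitImp [G.adj_comm]
  by_cases hx : ∃ v, G.Adj x v ∧ v ≠ y ∧ v ≠ z
  · obtain ⟨v, h1, h2, h3⟩ := hx
    exact hG.nonempty_iso_starPlusGraph_of_triangle hm h5 hxy hxz hyz
      (fun v' h => key hxy hxz hyz h1 h2 h3 h) (fun v' h => key hxz hxy hyz.symm h1 h3 h2 h)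
  by_cases hy : ∃ v, G.Adj y v ∧ v ≠ x ∧ v ≠ z
  · obtain ⟨v, h1, h2, h3⟩ := hy
    exact hG.nonempty_iso_starPlusGraph_of_triangle hm h5 hxy.symm hyz hxz
      (fun v' h => key hxy.symm hyz hxz h1 h2 h3 h)
      (fun v' h => key hyz hxy.symm hxz.symm h1 h3 h2 h)
  · exact hG.nonempty_iso_starPlusGraph_of_triangle hm h5 hxz.symm hyz.symm hxy
      (by grind) (by grind)

theorem SimpleGraph.Connected.nonempty_iso_doubleStar_of_path [Fintype V]
    (hG : G.Connected) {m : ℕ} (hm : Fintype.card V = m + 3)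
    (h5 : ∀ p q r s t, G.Adj p q → G.Adj q r → G.Adj r s → G.Adj s t →
      p ≠ r → p ≠ s → p ≠ t → q ≠ s → q ≠ t → r = t)
    (h3 : ∀ x y z, G.Adj x y → G.Adj y z → ¬ G.Adj x z)
    {b c d : V} (hbc : G.Adj b c) (hcd : G.Adj c d) (hbd : b ≠ d)
    (hc : ∀ v, G.Adj c v → v = b ∨ v = d) (hd : ∀ v, G.Adj d v → v = c) :
    Nonempty (G ≃g doubleStar m 1) := by
  have n1 := hbc.ne
  have n2 := hcd.ne
  have hcover := hG.mem_of_adj_closed (fun v => v = d ∨ v = b ∨ G.Adj b v) (x := d)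
    (Or.inl rfl) (by
    rintro u v (rfl | rfl | hbu) huv
    · grind
    · exact Or.inr (Or.inr huv)
    · by_contra hcon
      have := hbu.ne
      have := huv.ne
      have := huv.symm
      have := h5 v u b c d huv.symm hbu.symm hbc hcd
      clear h5 h3 hG
      grind +splitImp [G.adj_comm])
  refine nonempty_iso_doubleStar_one hm n1 hbd n2 fun u v => ⟨fun huv => ⟨huv.ne, ?_⟩, ?_⟩
  · have := huv.symm
    have := hcover u
    have := hcover v
    have := h3 b u v
    have := h3 b c d
    clear h5 h3 hG hcover
    grind +splitImp
  · have := hcover u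
    have := hcover v
    clear hcover
    grind +splitImp [G.adj_comm]

theorem SimpleGraph.Connected.nonempty_iso_doubleStar [Fintype V]
    (hG : G.Connected) (hp : ¬ HasRainbowPair G) {m : ℕ} (hm : Fintype.card V = m + 3)
    (h5 : ∀ p q r s t, G.Adj p q → G.Adj q r → G.Adj r s → G.Adj s t →
      p ≠ r → p ≠ s → p ≠ t → q ≠ s → q ≠ t → r = t)
    (h3 : ∀ x y z, G.Adj x y → G.Adj y z → ¬ G.Adj x z)
    {a b c d : V} (hab : G.Adj a b) (hbc : G.Adj b c) (hcd : G.Adj c d) (hac : a ≠ c)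
    (hbd : b ≠ d) : Nonempty (G ≃g doubleStar m 1) := by
  have key {a b c d : V} (hab : G.Adj a b) (hbc : G.Adj b c) (hcd : G.Adj c d) (hac : a ≠ c)
      (hbd : b ≠ d) (v : V) (hv : G.Adj d v) : v = c := by
    by_contra hvc
    have := not_adj_of_not_hasRainbowPair hp (u := b) (w := d) (a := a) (b := c) hbd hac
      hab.symm hbc
    have := h3 b c d hbc hcd
    have := h3 a b c hab hbc
    have := h5 a b c d v hab hbc hcd hv
    clear h5 h3 hG
    have := hab.ne
    have := hbc.ne
    have := hcd.ne
    have := hv.ne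
    grind +splitImp [G.adj_comm]
  have hd := key hab hbc hcd hac hbd
  have ha := key hcd.symm hbc.symm hab.symm hbd.symm hac.symm
  by_cases hc : ∀ v, G.Adj c v → v = b ∨ v = d
  · exact hG.nonempty_iso_doubleStar_of_path hm h5 h3 hbc hcd hbd hc hd
  · push Not at hc
    obtain ⟨w, hcw, hwb, hwd⟩ := hc
    refine hG.nonempty_iso_doubleStar_of_path hm h5 h3 hbc.symm hab.symm hac.symm ?_ ha
    by_contra! hb
    obtain ⟨v, hbv, hvc, hva⟩ := hb
    refine hp ⟨b, c, a, v, d, w, hbc.ne, hab.symm, hbv, hcd, hcw, ?_, ?_, hva.symm, ?_, ?_, hwd.symm⟩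
    · exact fun h => hbd (ha d h).symm
    · exact fun h => not_adj_of_not_hasRainbowPair hp hvc hwb h hbv.symm hcw hbc.symm
    · rintro rfl
      exact h3 _ _ _ hab hbc hcw.symm
    · rintro rfl
      exact h3 _ _ _ hbc hcd hbv

theorem SimpleGraph.Connected.classification_of_not_hasRainbowPair [Fintype V]
    (hG : G.Connected) (hn : 3 ≤ Fintype.card V) (hp : ¬ HasRainbowPair G) :
    Nonempty (G ≃g _root_.starGraph (Fintype.card V - 1)) ∨
      Nonempty (G ≃g starPlusGraph (Fintype.card V - 1)) ∨
      (4 ≤ Fintype.card V ∧ Nonempty (G ≃g doubleStar (Fintype.card V - 3) 1)) ∨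
      Nonempty (G ≃g SimpleGraph.cycleGraph 5) := by
  by_cases h5 : ∃ p q r s t, G.Adj p q ∧ G.Adj q r ∧ G.Adj r s ∧ G.Adj s t ∧ [p, q, r, s, t].Nodup
  · obtain ⟨p, q, r, s, t, hpq, hqr, hrs, hst, hnd⟩ := h5
    exact Or.inr (Or.inr (Or.inr (hG.nonempty_iso_cycleGraph_five hp hpq hqr hrs hst hnd)))
  replace h5 (p q r s t : V) (hpq : G.Adj p q) (hqr : G.Adj q r) (hrs : G.Adj r s)
      (hst : G.Adj s t) (h1 : p ≠ r) (h2 : p ≠ s) (h3 : p ≠ t) (h4 : q ≠ s) (h6 : q ≠ t) :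
      r = t := by
    by_contra h7
    exact h5 ⟨p, q, r, s, t, hpq, hqr, hrs, hst,
      by simp [hpq.ne, hqr.ne, hrs.ne, hst.ne, h1, h2, h3, h4, h6, h7]⟩
  by_cases h3 : ∃ x y z, G.Adj x y ∧ G.Adj y z ∧ G.Adj x z
  · obtain ⟨x, y, z, hxy, hyz, hxz⟩ := h3
    exact Or.inr (Or.inl (hG.nonempty_iso_starPlusGraph hp (by omega) h5 hxy hxz hyz))
  push Not at h3
  by_cases h4 : ∃ a b c d, G.Adj a b ∧ G.Adj b c ∧ G.Adj c d ∧ a ≠ c ∧ b ≠ d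
  · obtain ⟨a, b, c, d, hab, hbc, hcd, hac, hbd⟩ := h4
    refine Or.inr (Or.inr (Or.inl
      ⟨?_, hG.nonempty_iso_doubleStar hp (by omega) h5 h3 hab hbc hcd hac hbd⟩))
    have hnd : [a, b, c, d].Nodup := by
      clear h5
      have := h3 a b c hab hbc
      have := hab.ne
      have := hbc.ne
      have := hcd.ne
      grind +splitImp [G.adj_comm]
    simpa using hnd.length_le_card
  push Not at h4
  left
  obtain ⟨x, a, b, hxa, hxb, hab⟩ := hG.exists_two_neighbors hn
  have hcover := hG.mem_of_adj_closed (fun v => v = x ∨ G.Adj x v) (x := x) (Or.inl rfl) (by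
    rintro u v (rfl | hxu) huv
    · exact Or.inr huv
    · left
      by_contra hvx
      have h1 := h4 v u x a huv.symm hxu.symm hxa hvx
      have h2 := h4 v u x b huv.symm hxu.symm hxb hvx
      exact hab (h1.symm.trans h2))
  refine nonempty_iso_starGraph (m := Fintype.card V - 1) (x := x) (by omega) fun u v => ⟨fun huv => ⟨huv.ne, ?_⟩, ?_⟩
  · by_contra hcon
    exact h3 x u v (by grind) huv (by grind)
  · have := hcover u
    have := hcover v
    clear hcover
    grind +splitImp [G.adj_comm]

end Classification

theorem stmt_1 {V : Type*} [Fintype V] (G : SimpleGraph V) (n : ℕ)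
    (hcard : Fintype.card V = n) (hn : 3 ≤ n) (hconn : G.Connected) :
    riNumber G 2 = n - 1 ↔
      (Nonempty (G ≃g starGraph (n - 1)) ∨
       Nonempty (G ≃g starPlusGraph (n - 1)) ∨
       (4 ≤ n ∧ Nonempty (G ≃g doubleStar (n - 3) 1)) ∨
       Nonempty (G ≃g SimpleGraph.cycleGraph 5)) := by
  subst hcard
  rw [hconn.riNumber_two_eq_iff hn]
  constructor
  · exact hconn.classification_of_not_hasRainbowPair hn
  · rintro (⟨⟨e⟩⟩ | ⟨⟨e⟩⟩ | ⟨-, ⟨e⟩⟩ | ⟨⟨e⟩⟩) h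
    · exact not_hasRainbowPair_starGraph _ (h.of_iso e)
    · exact not_hasRainbowPair_starPlusGraph _ (h.of_iso e)
    · exact not_hasRainbowPair_doubleStar_one _ (h.of_iso e)
    · exact not_hasRainbowPair_cycleGraph_five (h.of_iso e)
end

section
/- Let G be a graph of order n ≥ 3. If G is isomorphic to S_{n−1}, to S_{n−1}^+, or to S(n−3,1), then γ_ri2 of the complement of G is at most 3. -/
open scoped Classical

/-- If `ab` is an edge of `G`, `c` is a third vertex, and no other vertex is adjacent to `b` or
`c`, then colouring `a, b` with `1` and `c` with `2` is a 2-rainbow independent dominating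
function of the complement of `G`. -/
theorem riNumber_compl_le_three {V : Type*} [Fintype V] (G : SimpleGraph V) (a b c : V)
    (hab : G.Adj a b) (hac : a ≠ c) (hbc : b ≠ c)
    (h : ∀ v, v ≠ a → v ≠ b → v ≠ c → ¬ G.Adj v b ∧ ¬ G.Adj v c) :
    riNumber Gᶜ 2 ≤ 3 := by
  let f : V → ℕ := fun v => if v = c then 2 else if v = a ∨ v = b then 1 else 0
  have hf_one : ∀ v, f v = 1 → v = a ∨ v = b := by
    intro v hv
    simp only [f] at hv
    split_ifs at hv <;> first | assumption | omega
  have hf_two : ∀ v, f v = 2 → v = c := by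
    intro v hv
    simp only [f] at hv
    split_ifs at hv <;> first | assumption | omega
  have hf : IsKRiDF Gᶜ 2 f := by
    refine ⟨fun v => ?_, fun i hi hi' u v hu hv huv => ?_, fun v hv i hi hi' => ?_⟩
    · simp only [f]
      split_ifs <;> omega
    · rw [SimpleGraph.compl_adj] at huv
      interval_cases i
      · rcases hf_one u hu with rfl | rfl <;> rcases hf_one v hv with rfl | rfl
        · exact huv.1 rfl
        · exact huv.2 hab
        · exact huv.2 hab.symm
        · exact huv.1 rfl
      · exact huv.1 ((hf_two u hu).trans (hf_two v hv).symm)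
    · have hvc : v ≠ c := by
        rintro rfl
        simp [f] at hv
      have hvab : ¬ (v = a ∨ v = b) := by
        intro hv'
        simp [f, hvc, hv'] at hv
      push Not at hvab
      obtain ⟨hb, hc⟩ := h v hvab.1 hvab.2 hvc
      interval_cases i
      · exact ⟨b, (SimpleGraph.compl_adj ..).2 ⟨hvab.2, hb⟩, by simp [f, hbc]⟩
      · exact ⟨c, (SimpleGraph.compl_adj ..).2 ⟨hvc, hc⟩, by simp [f]⟩
  have hle : riNumber Gᶜ 2 ≤ riWeight f := Nat.sInf_le ⟨f, hf, rfl⟩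
  refine hle.trans ?_
  refine (Finset.card_le_card (t := {a, b, c}) fun v hv => ?_).trans Finset.card_le_three
  have hv0 : f v ≠ 0 := (Finset.mem_filter.1 hv).2
  simp only [f] at hv0
  split_ifs at hv0 <;> simp_all

/-- `riNumber_compl_le_three` with the three vertices given in an isomorphic copy of `G`. -/
theorem riNumber_compl_le_three_of_iso {V W : Type*} [Fintype V] {G : SimpleGraph V}
    {H : SimpleGraph W} (e : G ≃g H) (a b c : W)
    (hab : H.Adj a b) (hac : a ≠ c) (hbc : b ≠ c)
    (hb : ∀ v, v ≠ a → v ≠ b → v ≠ c → ¬ H.Adj v b)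
    (hc : ∀ v, v ≠ a → v ≠ b → v ≠ c → ¬ H.Adj v c) :
    riNumber Gᶜ 2 ≤ 3 := by
  refine riNumber_compl_le_three G (e.symm a) (e.symm b) (e.symm c)
    (e.symm.map_adj_iff.2 hab) (e.symm.injective.ne hac) (e.symm.injective.ne hbc) ?_
  intro v hva hvb hvc
  have key : ∀ w, v ≠ e.symm w → e v ≠ w := by
    rintro w hw rfl
    exact hw (e.symm_apply_apply v).symm
  have adj : ∀ w, G.Adj v (e.symm w) ↔ H.Adj (e v) w := by
    intro w
    rw [← e.map_adj_iff, e.apply_symm_apply]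
  rw [adj, adj]
  exact ⟨hb _ (key a hva) (key b hvb) (key c hvc), hc _ (key a hva) (key b hvb) (key c hvc)⟩

theorem stmt_3 {V : Type*} [Fintype V] (G : SimpleGraph V) (n : ℕ)
    (hcard : Fintype.card V = n) (hn : 3 ≤ n)
    (h : Nonempty (G ≃g starGraph (n - 1)) ∨
         Nonempty (G ≃g starPlusGraph (n - 1)) ∨
         Nonempty (G ≃g doubleStar (n - 3) 1)) :
    riNumber Gᶜ 2 ≤ 3 := by
  rcases h with ⟨⟨e⟩⟩ | ⟨⟨e⟩⟩ | ⟨⟨e⟩⟩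
  · refine riNumber_compl_le_three_of_iso e ⟨0, by omega⟩ ⟨1, by omega⟩ ⟨2, by omega⟩
      ?_ ?_ ?_ ?_ ?_ <;>
      intros <;>
      simp only [starGraph, SimpleGraph.fromRel_adj, ne_eq, Fin.ext_iff] at * <;>
      grind
  · refine riNumber_compl_le_three_of_iso e ⟨0, by omega⟩ ⟨1, by omega⟩ ⟨2, by omega⟩
      ?_ ?_ ?_ ?_ ?_ <;>
      intros <;>
      simp only [starPlusGraph, SimpleGraph.fromRel_adj, ne_eq, Fin.ext_iff] at * <;>
      grind
  · refine riNumber_compl_le_three_of_iso e ⟨0, by omega⟩ ⟨1, by omega⟩ ⟨n - 1, by omega⟩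
      ?_ ?_ ?_ ?_ ?_ <;>
      intros <;>
      simp only [doubleStar, SimpleGraph.fromRel_adj, ne_eq, Fin.ext_iff] at * <;>
      grind
end

section
/- Let G be a graph of order n. If G is not isomorphic to the 5-cycle C_5 and γ_ri2(G) = 4, then γ_ri2 of the complement of G is at most n − 2. -/
open scoped Classical

section RainbowExtension

variable {V : Type*} [Fintype V] (H : SimpleGraph V)

/-- Two disjoint independent sets extend to disjoint independent sets which both dominate every
remaining vertex. -/
theorem exists_dominating_extension (P Q : Finset V) (hP : ∀ u ∈ P, ∀ v ∈ P, ¬ H.Adj u v)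
    (hQ : ∀ u ∈ Q, ∀ v ∈ Q, ¬ H.Adj u v) (hPQ : ∀ u ∈ P, u ∉ Q) :
    ∃ P' Q' : Finset V, P ⊆ P' ∧ Q ⊆ Q' ∧ (∀ u ∈ P', ∀ v ∈ P', ¬ H.Adj u v) ∧
      (∀ u ∈ Q', ∀ v ∈ Q', ¬ H.Adj u v) ∧ (∀ u ∈ P', u ∉ Q') ∧
      ∀ v, v ∉ P' → v ∉ Q' → (∃ u ∈ P', H.Adj v u) ∧ ∃ u ∈ Q', H.Adj v u := by
  obtain ⟨⟨P', Q'⟩, ⟨hPP, hQQ⟩, hmax⟩ := Finite.exists_le_maximal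
    (p := fun R : Finset V × Finset V => (∀ u ∈ R.1, ∀ v ∈ R.1, ¬ H.Adj u v) ∧
      (∀ u ∈ R.2, ∀ v ∈ R.2, ¬ H.Adj u v) ∧ ∀ u ∈ R.1, u ∉ R.2) (a := (P, Q)) ⟨hP, hQ, hPQ⟩
  obtain ⟨⟨h1, h2, h3⟩, hm⟩ := hmax
  refine ⟨P', Q', hPP, hQQ, h1, h2, h3, fun v hvP hvQ => ⟨?_, ?_⟩⟩
  · by_contra! hcon
    have := hm (y := (insert v P', Q'))
      ⟨by simp only [Finset.mem_insert]; grind [H.adj_comm, H.irrefl], h2,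
        by simp only [Finset.mem_insert]; grind⟩ ⟨Finset.subset_insert _ _, le_rfl⟩
    exact hvP (this.1 (Finset.mem_insert_self _ _))
  · by_contra! hcon
    have := hm (y := (P', insert v Q'))
      ⟨h1, by simp only [Finset.mem_insert]; grind [H.adj_comm, H.irrefl],
        by simp only [Finset.mem_insert]; grind⟩ ⟨le_rfl, Finset.subset_insert _ _⟩
    exact hvQ (this.2 (Finset.mem_insert_self _ _))

/-- Disjoint independent sets which both dominate every remaining vertex bound the
2-rainbow independent domination number. -/
theorem riNumber_two_le_card_union (P Q : Finset V) (hP : ∀ u ∈ P, ∀ v ∈ P, ¬ H.Adj u v)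
    (hQ : ∀ u ∈ Q, ∀ v ∈ Q, ¬ H.Adj u v) (hPQ : ∀ u ∈ P, u ∉ Q)
    (hdom : ∀ v, v ∉ P → v ∉ Q → (∃ u ∈ P, H.Adj v u) ∧ ∃ u ∈ Q, H.Adj v u) :
    riNumber H 2 ≤ (P ∪ Q).card := by
  set f : V → ℕ := fun v => if v ∈ P then 1 else if v ∈ Q then 2 else 0 with hf
  have f1 : ∀ v, f v = 1 ↔ v ∈ P := by intro v; simp only [hf]; grind
  have f2 : ∀ v, f v = 2 ↔ v ∈ Q := by intro v; simp only [hf]; grind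
  have f0 : ∀ v, f v ≠ 0 ↔ v ∈ P ∪ Q := by
    intro v; simp only [hf, Finset.mem_union]; grind
  refine Nat.sInf_le ⟨f, ⟨fun v => ?_, fun i hi1 hi2 u v hu hv => ?_, fun v hv i hi1 hi2 => ?_⟩, ?_⟩
  · simp only [hf]; grind
  · obtain rfl | rfl : i = 1 ∨ i = 2 := by omega
    · exact hP u ((f1 u).1 hu) v ((f1 v).1 hv)
    · exact hQ u ((f2 u).1 hu) v ((f2 v).1 hv)
  · have hv' : v ∉ P ∪ Q := fun h => (f0 v).2 h hv
    rw [Finset.mem_union, not_or] at hv'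
    obtain ⟨⟨u, hu, hvu⟩, ⟨w, hw, hvw⟩⟩ := hdom v hv'.1 hv'.2
    obtain rfl | rfl : i = 1 ∨ i = 2 := by omega
    · exact ⟨u, hvu, (f1 u).2 hu⟩
    · exact ⟨w, hvw, (f2 w).2 hw⟩
  · unfold riWeight
    congr 1
    ext v
    simp [f0]

theorem riNumber_two_le_card : riNumber H 2 ≤ Fintype.card V := by
  obtain ⟨P, Q, -, -, hP, hQ, hPQ, hdom⟩ :=
    exists_dominating_extension H ∅ ∅ (by simp) (by simp) (by simp)
  exact (riNumber_two_le_card_union H P Q hP hQ hPQ hdom).trans (Finset.card_le_univ _)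

theorem riNumber_two_le_card_sub_two (P Q : Finset V) (hP : ∀ u ∈ P, ∀ v ∈ P, ¬ H.Adj u v)
    (hQ : ∀ u ∈ Q, ∀ v ∈ Q, ¬ H.Adj u v) (hPQ : ∀ u ∈ P, u ∉ Q)
    (hdom : ∀ v, v ∉ P → v ∉ Q → (∃ u ∈ P, H.Adj v u) ∧ ∃ u ∈ Q, H.Adj v u)
    {p q : V} (hpq : p ≠ q) (hp : p ∉ P ∪ Q) (hq : q ∉ P ∪ Q) :
    riNumber H 2 ≤ Fintype.card V - 2 := by
  refine (riNumber_two_le_card_union H P Q hP hQ hPQ hdom).trans ?_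
  have h : P ∪ Q ⊆ ({p, q} : Finset V)ᶜ := by
    intro v hv
    simp only [Finset.mem_compl, Finset.mem_insert, Finset.mem_singleton]
    rintro (rfl | rfl) <;> contradiction
  refine (Finset.card_le_card h).trans ?_
  rw [Finset.card_compl, Finset.card_pair hpq]

end RainbowExtension

/-- The graph `H` is the pentagon with consecutive vertices `x, b, c, d, a`. -/
def IsPentagon {V : Type*} (H : SimpleGraph V) (x b c d a : V) : Prop :=
  [x, b, c, d, a].Nodup ∧ (∀ v, v = x ∨ v = b ∨ v = c ∨ v = d ∨ v = a) ∧
    H.Adj x b ∧ H.Adj b c ∧ H.Adj c d ∧ H.Adj d a ∧ H.Adj a x ∧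
    ¬ H.Adj x c ∧ ¬ H.Adj x d ∧ ¬ H.Adj b d ∧ ¬ H.Adj b a ∧ ¬ H.Adj c a

theorem IsPentagon.nonempty_compl_iso {V : Type*} {G : SimpleGraph V} {x b c d a : V}
    (h : IsPentagon Gᶜ x b c d a) : Nonempty (G ≃g SimpleGraph.cycleGraph 5) := by
  obtain ⟨hnd, hall, h1, h2, h3, h4, h5, h6, h7, h8, h9, h10⟩ := h
  simp only [List.nodup_cons, List.mem_cons, List.not_mem_nil, or_false, not_or] at hnd
  simp only [SimpleGraph.compl_adj] at *
  have hinj : Function.Injective ![x, c, a, b, d] := by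
    intro i j hij
    fin_cases i <;> fin_cases j <;> simp at hij ⊢ <;> grind
  have hsurj : Function.Surjective ![x, c, a, b, d] := by
    intro v
    obtain h | h | h | h | h := hall v
    exacts [⟨0, h.symm⟩, ⟨3, h.symm⟩, ⟨1, h.symm⟩, ⟨4, h.symm⟩, ⟨2, h.symm⟩]
  have hadj : ∀ i j, G.Adj (![x, c, a, b, d] i) (![x, c, a, b, d] j) ↔
      (SimpleGraph.cycleGraph 5).Adj i j := by
    intro i j
    fin_cases i <;> fin_cases j <;>
      first
      | refine iff_of_true ?_ (by decide)
        simp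
        grind [G.adj_comm]
      | refine iff_of_false ?_ (by decide)
        simp <;> grind [G.adj_comm]
  exact ⟨SimpleGraph.Iso.symm ⟨Equiv.ofBijective _ ⟨hinj, hsurj⟩, fun {i j} => hadj i j⟩⟩

/-- The local conditions on the complement `H` of a graph `G` which follow from `γ_ri2(G) ≥ 4` and
`γ_ri2(H) ≥ n - 1`. -/
structure IsRainbowExtremal {V : Type*} (H : SimpleGraph V) : Prop where
  pair : ∀ u v, u ≠ v → ∃ w, w ≠ u ∧ w ≠ v ∧ (H.Adj w u ∨ H.Adj w v)
  edge : ∀ u u' v, H.Adj u u' → v ≠ u → v ≠ u' →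
    ∃ w, w ≠ u ∧ w ≠ u' ∧ w ≠ v ∧ (H.Adj w v ∨ (H.Adj w u ∧ H.Adj w u'))
  bichromatic : ∀ p q p₁ p₂ q₁ q₂, p ≠ q → H.Adj p p₁ → H.Adj p p₂ → H.Adj q q₁ → H.Adj q q₂ →
    p₁ ≠ p₂ → q₁ ≠ q₂ → p₁ ≠ q₂ → p₂ ≠ q₁ → ¬ H.Adj p₁ q₁ → ¬ H.Adj p₂ q₂ → False

theorem isRainbowExtremal_compl {V : Type*} [Fintype V] (G : SimpleGraph V)
    (h4 : 4 ≤ riNumber G 2) (hc : ¬ riNumber Gᶜ 2 ≤ Fintype.card V - 2) :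
    IsRainbowExtremal Gᶜ where
  pair u v huv := by
    by_contra! hcon
    have := riNumber_two_le_card_union G {u} {v} (by simp) (by simp) (by simpa using huv) (by
      intro w hwu hwv
      simp only [Finset.mem_singleton, SimpleGraph.compl_adj] at *
      grind)
    have := Finset.card_union_le {u} {v}
    simp only [Finset.card_singleton] at this
    omega
  edge u u' v huu' hvu hvu' := by
    by_contra! hcon
    rw [SimpleGraph.compl_adj] at huu'
    have := riNumber_two_le_card_union G {u, u'} {v}
      (by simp only [Finset.mem_insert, Finset.mem_singleton]; grind [G.adj_comm, G.irrefl])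
      (by simp) (by simp only [Finset.mem_insert, Finset.mem_singleton]; grind) (by
      intro w hwu hwv
      simp only [Finset.mem_insert, Finset.mem_singleton, SimpleGraph.compl_adj] at *
      grind)
    have := Finset.card_union_le {u, u'} {v}
    have := Finset.card_le_two (a := u) (b := u')
    simp only [Finset.card_singleton] at *
    omega
  bichromatic p q p₁ p₂ q₁ q₂ hpq hp₁ hp₂ hq₁ hq₂ hp hq h₁₂ h₂₁ h₁ h₂ := by
    generalize Gᶜ = H at *
    obtain ⟨P, Q, hPP, hQQ, hP, hQ, hPQ, hdom⟩ :=
      exists_dominating_extension H {p₁, q₁} {p₂, q₂}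
        (by simp only [Finset.mem_insert, Finset.mem_singleton]; grind [H.adj_comm, H.irrefl])
        (by simp only [Finset.mem_insert, Finset.mem_singleton]; grind [H.adj_comm, H.irrefl])
        (by simp only [Finset.mem_insert, Finset.mem_singleton]; grind)
    simp only [Finset.insert_subset_iff, Finset.singleton_subset_iff] at hPP hQQ
    refine hc (riNumber_two_le_card_sub_two H P Q hP hQ hPQ hdom hpq ?_ ?_)
    · rw [Finset.mem_union]; grind
    · rw [Finset.mem_union]; grind

namespace IsRainbowExtremal

variable {V : Type*} {H : SimpleGraph V}

/-- The edges at the neighbour of a pendant vertex, other than the pendant edge, are in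
triangles. -/
theorem exists_common_neighbor (hH : IsRainbowExtremal H) {u u' v : V} (huu' : H.Adj u u')
    (hvu : v ≠ u) (hvu' : v ≠ u') (hv : ∀ w, H.Adj v w → w = u) :
    ∃ w, H.Adj w u ∧ H.Adj w u' := by
  obtain ⟨w, hw⟩ := hH.edge u u' v huu' hvu hvu'
  grind [H.adj_comm]

/-- Two vertices cannot each have two neighbours inside one independent set. -/
theorem not_two_of_independent (hH : IsRainbowExtremal H) (S : V → Prop)
    (hS : ∀ u v, S u → S v → ¬ H.Adj u v) {p q p₁ p₂ q₁ q₂ : V} (hpq : p ≠ q)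
    (hp₁ : H.Adj p p₁) (hp₂ : H.Adj p p₂) (hq₁ : H.Adj q q₁) (hq₂ : H.Adj q q₂)
    (hp : p₁ ≠ p₂) (hq : q₁ ≠ q₂) (sp₁ : S p₁) (sp₂ : S p₂) (sq₁ : S q₁) (sq₂ : S q₂) : False := by
  by_cases h : p₁ ≠ q₂ ∧ p₂ ≠ q₁
  · exact hH.bichromatic p q p₁ p₂ q₁ q₂ hpq hp₁ hp₂ hq₁ hq₂ hp hq h.1 h.2
      (hS _ _ sp₁ sq₁) (hS _ _ sp₂ sq₂)
  · exact hH.bichromatic p q p₁ p₂ q₂ q₁ hpq hp₁ hp₂ hq₂ hq₁ hp hq.symm (by grind) (by grind)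
      (hS _ _ sp₁ sq₂) (hS _ _ sp₂ sq₁)

theorem not_bipartite (hH : IsRainbowExtremal H) [Nontrivial V] (s : V → Prop)
    (hs : ∀ u v, H.Adj u v → (s u ↔ ¬ s v)) : False := by
  have key : ∀ u v w, H.Adj u v → H.Adj u w → v ≠ w → False := by
    intro u v w huv huw hvw
    have pend : ∀ v w, H.Adj u v → H.Adj u w → v ≠ w → (∀ z, H.Adj v z → z = u) → False := by
      intro v w huv huw hvw hv
      obtain ⟨z, hz⟩ := hH.exists_common_neighbor huw huv.ne' hvw hv
      grind
    by_cases hv : ∀ z, H.Adj v z → z = u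
    · exact pend v w huv huw hvw hv
    by_cases hw : ∀ z, H.Adj w z → z = u
    · exact pend w v huw huv hvw.symm hw
    push Not at hv hw
    obtain ⟨z, hvz, hzu⟩ := hv
    obtain ⟨y, hwy, hyu⟩ := hw
    exact hH.not_two_of_independent (fun t => s t ↔ s u) (by grind) hvw huv.symm hvz huw.symm hwy
      hzu.symm hyu.symm (by grind) (by grind) (by grind) (by grind)
  obtain ⟨u, v, huv⟩ := exists_pair_ne V
  have hedge : ∃ u v, H.Adj u v := by
    obtain ⟨w, -, -, h | h⟩ := hH.pair u v huv <;> exact ⟨_, _, h⟩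
  obtain ⟨u, v, huv⟩ := hedge
  obtain ⟨w, hwu, hwv, h | h⟩ := hH.pair u v huv.ne
  · exact key u v w huv h.symm hwv.symm
  · exact key v u w huv.symm h.symm hwu.symm

/-- In a graph which becomes bipartite after removing the edge `xa` between two vertices of one
side, a 5-cycle through this edge is the whole graph. -/
theorem isPentagon_of_cycle (hH : IsRainbowExtremal H) (s : V → Prop) {x a : V}
    (hxa : H.Adj x a) (sx : s x) (sa : s a)
    (hs : ∀ u v, H.Adj u v → (s u ↔ ¬ s v) ∨ (u = x ∧ v = a) ∨ (u = a ∧ v = x))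
    {b c d : V} (sb : ¬ s b) (sc : s c) (sd : ¬ s d) (hbd : b ≠ d)
    (hcx : c ≠ x) (hca : c ≠ a) (hxb : H.Adj x b) (hbc : H.Adj b c) (hcd : H.Adj c d)
    (hda : H.Adj d a) : IsPentagon H x b c d a := by
  have hsymm : ∀ u v, H.Adj u v → H.Adj v u := fun _ _ h => h.symm
  have hirr := fun v => H.irrefl (v := v)
  have hS : ∀ u v, ¬ s u → ¬ s v → ¬ H.Adj u v := by grind
  have hSa : ∀ u v, (s u ∧ u ≠ a) → (s v ∧ v ≠ a) → ¬ H.Adj u v := by grind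
  have nb : ∀ t, H.Adj b t → t = x ∨ t = c := by
    intro t ht
    by_contra! hcon
    by_cases hta : t = a
    · subst hta
      exact hH.bichromatic b d t x t c hbd ht hxb.symm hda hcd.symm (by grind) (by grind)
        (by grind) (by grind) (by grind) (by grind)
    · exact hH.bichromatic b d x t c a hbd hxb.symm ht hcd.symm hda (by grind) (by grind)
        (by grind) (by grind) (by grind) (by grind)
  have nd : ∀ t, H.Adj d t → t = a ∨ t = c := by
    intro t ht
    by_contra! hcon
    by_cases htx : t = x
    · subst htx
      exact hH.bichromatic b d t c t a hbd hxb.symm hbc ht hda (by grind) (by grind)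
        (by grind) (by grind) (by grind) (by grind)
    · exact hH.bichromatic b d x c t a hbd hxb.symm hbc ht hda (by grind) (by grind)
        (by grind) (by grind) (by grind) (by grind)
  have hside : ∀ t t₁ t₂, s t → t ≠ c → ¬ s t₁ → ¬ s t₂ → H.Adj t t₁ → H.Adj t t₂ → t₁ = t₂ := by
    intro t t₁ t₂ st htc st₁ st₂ ht₁ ht₂
    by_contra hne
    exact hH.not_two_of_independent (fun v => ¬ s v) hS htc ht₁ ht₂ hbc.symm hcd hne hbd
      st₁ st₂ sb sd
  have nx : ∀ t, H.Adj x t → t = a ∨ t = b := by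
    intro t ht
    have := hside x t b
    grind
  have na : ∀ t, H.Adj a t → t = x ∨ t = d := by
    intro t ht
    have := hside a t d
    grind
  have hother : ∀ t t₁ t₂, t ≠ x → t ≠ b → t ≠ c → t ≠ d → t ≠ a → H.Adj t t₁ → H.Adj t t₂ →
      t₁ = t₂ := by
    intro t t₁ t₂ htx htb htc htd hta ht₁ ht₂
    by_cases st : s t
    · exact hside t t₁ t₂ st htc (by grind) (by grind) ht₁ ht₂
    · by_contra hne
      exact hH.not_two_of_independent (fun v => s v ∧ v ≠ a) hSa htb ht₁ ht₂ hxb.symm hbc hne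
        hcx.symm (by grind) (by grind) (by grind) (by grind)
  have hall : ∀ v, v = x ∨ v = b ∨ v = c ∨ v = d ∨ v = a := by
    intro v
    by_contra! hv
    obtain ⟨hvx, hvb, hvc, hvd, hva⟩ := hv
    have hcon : ¬ ∀ w, H.Adj v w → w = c := by
      intro h
      obtain ⟨w, hw⟩ := hH.exists_common_neighbor hbc.symm hvc hvb h
      grind
    push Not at hcon
    obtain ⟨w, hvw, hwc⟩ := hcon
    obtain ⟨z, hz⟩ := hH.pair v w hvw.ne
    have hw : ∀ t, H.Adj w t → t = v := fun t ht =>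
      hother w t v (by grind) (by grind) hwc (by grind) (by grind) ht hvw.symm
    have hv : ∀ t, H.Adj v t → t = w := fun t ht => hother v t w hvx hvb hvc hvd hva ht hvw
    grind
  refine ⟨by simp; grind, hall, hxb, hbc, hcd, hda, hxa.symm, ?_, ?_, ?_, ?_, ?_⟩ <;> grind

/-- If `H` becomes bipartite after removing the edge `xa` inside one side, two vertices of degree at
least two on the other side force a pentagon. -/
theorem exists_pentagon_of_two (hH : IsRainbowExtremal H) (s : V → Prop) {x a : V}
    (hxa : H.Adj x a) (sx : s x) (sa : s a)
    (hs : ∀ u v, H.Adj u v → (s u ↔ ¬ s v) ∨ (u = x ∧ v = a) ∨ (u = a ∧ v = x))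
    {b d : V} (hbd : b ≠ d) (sb : ¬ s b) (sd : ¬ s d)
    {b₁ b₂ d₁ d₂ : V} (hb : b₁ ≠ b₂) (hd : d₁ ≠ d₂) (hb₁ : H.Adj b b₁) (hb₂ : H.Adj b b₂)
    (hd₁ : H.Adj d d₁) (hd₂ : H.Adj d d₂) : ∃ x b c d a, IsPentagon H x b c d a := by
  have hsymm : ∀ u v, H.Adj u v → H.Adj v u := fun _ _ h => h.symm
  have hcase : ∃ c, H.Adj b c ∧ H.Adj d c ∧ c ≠ x ∧ c ≠ a ∧
      ((H.Adj b x ∧ H.Adj d a) ∨ (H.Adj d x ∧ H.Adj b a)) := by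
    have h₁ : b₁ = d₂ ∨ b₂ = d₁ ∨ H.Adj b₁ d₁ ∨ H.Adj b₂ d₂ := by
      by_contra! h
      exact hH.bichromatic b d b₁ b₂ d₁ d₂ hbd hb₁ hb₂ hd₁ hd₂ hb hd h.1 h.2.1 h.2.2.1 h.2.2.2
    have h₂ : b₁ = d₁ ∨ b₂ = d₂ ∨ H.Adj b₁ d₂ ∨ H.Adj b₂ d₁ := by
      by_contra! h
      exact hH.bichromatic b d b₁ b₂ d₂ d₁ hbd hb₁ hb₂ hd₂ hd₁ hb hd.symm h.1 h.2.1 h.2.2.1 h.2.2.2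
    have hne := hxa.ne
    have hside : ∀ u v, s u → s v → H.Adj u v → (u = x ∧ v = a) ∨ (u = a ∧ v = x) := by grind
    have sb₁ : s b₁ := by grind
    have sb₂ : s b₂ := by grind
    have sd₁ : s d₁ := by grind
    have sd₂ : s d₂ := by grind
    have e₁₁ := hside b₁ d₁ sb₁ sd₁
    have e₁₂ := hside b₁ d₂ sb₁ sd₂
    have e₂₁ := hside b₂ d₁ sb₂ sd₁
    have e₂₂ := hside b₂ d₂ sb₂ sd₂
    by_cases h : b₁ = d₁ ∨ b₂ = d₂
    · obtain rfl | rfl := h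
      · exact ⟨b₁, hb₁, hd₁, by grind⟩
      · exact ⟨b₂, hb₂, hd₂, by grind⟩
    · by_cases h : b₁ = d₂ ∨ b₂ = d₁
      · obtain rfl | rfl := h
        · exact ⟨b₁, hb₁, hd₂, by grind⟩
        · exact ⟨b₂, hb₂, hd₁, by grind⟩
      · grind
  obtain ⟨c, hbc, hdc, hcx, hca, ⟨h₁, h₂⟩ | ⟨h₁, h₂⟩⟩ := hcase
  · exact ⟨x, b, c, d, a, isPentagon_of_cycle hH s hxa sx sa hs sb (by grind) sd hbd hcx hca
      h₁.symm hbc hdc.symm h₂⟩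
  · exact ⟨x, d, c, b, a, isPentagon_of_cycle hH s hxa sx sa hs sd (by grind) sb hbd.symm hcx hca
      h₁.symm hdc hbc.symm h₂⟩

theorem exists_pentagon_of_neighbors_subset (hH : IsRainbowExtremal H) (s : V → Prop) {x a : V}
    (hxa : H.Adj x a) (sx : s x) (sa : s a)
    (hs : ∀ u v, H.Adj u v → (s u ↔ ¬ s v) ∨ (u = x ∧ v = a) ∨ (u = a ∧ v = x))
    {b d : V} (sb : ¬ s b) (sd : ¬ s d) (hxb : H.Adj x b)
    (had : H.Adj a d) (hx : ∀ t, H.Adj x t → t = a ∨ t = b) :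
    ∃ x b c d a, IsPentagon H x b c d a := by
  have hsymm : ∀ u v, H.Adj u v → H.Adj v u := fun _ _ h => h.symm
  have hirr := fun v => H.irrefl (v := v)
  by_cases hab : H.Adj a b
  · obtain ⟨w, hw⟩ := hH.edge a b x hab (by grind) (by grind)
    grind
  have hb : ¬ ∀ w, H.Adj b w → w = x := by
    intro h
    obtain ⟨w, hw⟩ := hH.exists_common_neighbor hxa hxb.ne' (by grind) h
    grind
  have hd : ¬ ∀ w, H.Adj d w → w = a := by
    intro h
    obtain ⟨w, hw⟩ := hH.exists_common_neighbor hxa.symm had.ne' (by grind) h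
    grind
  push Not at hb hd
  obtain ⟨y, hby, hyx⟩ := hb
  obtain ⟨z, hdz, hza⟩ := hd
  exact exists_pentagon_of_two hH s hxa sx sa hs (by grind) sb sd hyx hza hby hxb.symm hdz had.symm

theorem exists_pentagon_of_edge (hH : IsRainbowExtremal H) (s : V → Prop) {x a : V}
    (hxa : H.Adj x a) (sx : s x) (sa : s a)
    (hs : ∀ u v, H.Adj u v → (s u ↔ ¬ s v) ∨ (u = x ∧ v = a) ∨ (u = a ∧ v = x))
    {b d : V} (sb : ¬ s b) (sd : ¬ s d) (hxb : H.Adj x b)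
    (had : H.Adj a d) : ∃ x b c d a, IsPentagon H x b c d a := by
  by_cases hx : ∀ t, H.Adj x t → t = a ∨ t = b
  · exact exists_pentagon_of_neighbors_subset hH s hxa sx sa hs sb sd hxb had hx
  by_cases ha : ∀ t, H.Adj a t → t = x ∨ t = d
  · exact exists_pentagon_of_neighbors_subset hH s hxa.symm sa sx (by grind) sd sb had hxb ha
  push Not at hx ha
  obtain ⟨y, hxy, hya, hyb⟩ := hx
  obtain ⟨z, haz, hzx, hzd⟩ := ha
  exact (hH.not_two_of_independent (fun t => ¬ s t) (by grind) hxa.ne hxy hxb haz had hyb hzd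
    (by grind) sb (by grind) sd).elim

theorem exists_pentagon_of_unique (hH : IsRainbowExtremal H) (s : V → Prop) {x : V}
    (hs : ∀ u v, H.Adj u v → (s u ↔ ¬ s v) ∨ u = x ∨ v = x)
    [Nontrivial V] {a b : V} (hxa : H.Adj x a) (sa : s a)
    (hxb : H.Adj x b) (sb : ¬ s b) (ha : ∀ t, H.Adj x t → s t → t = a) :
    ∃ x b c d a, IsPentagon H x b c d a := by
  have hsymm : ∀ u v, H.Adj u v → H.Adj v u := fun _ _ h => h.symm
  have hirr := fun v => H.irrefl (v := v)
  by_cases had : ∃ d, d ≠ x ∧ ¬ s d ∧ H.Adj a d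
  · obtain ⟨d, hdx, sd, had⟩ := had
    exact exists_pentagon_of_edge hH (fun v => v = x ∨ s v) hxa (by grind) (by grind) (by grind)
      (b := b) (d := d) (by grind) (by grind) hxb had
  · exact (hH.not_bipartite (fun v => v = x ∨ (s v ∧ v ≠ a)) (by grind)).elim

/-- If one side contains two neighbours of `x`, one of its vertices is pendant at `x`. -/
theorem exists_pendant (hH : IsRainbowExtremal H) (s : V → Prop) {x : V}
    (hs : ∀ u v, H.Adj u v → (s u ↔ ¬ s v) ∨ u = x ∨ v = x)
    {a₁ a₂ : V} (ha : a₁ ≠ a₂)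
    (hxa₁ : H.Adj x a₁) (hxa₂ : H.Adj x a₂) (sa₁ : s a₁) (sa₂ : s a₂) :
    ∃ v, s v ∧ H.Adj x v ∧ ∀ t, H.Adj v t → t = x := by
  have hsymm : ∀ u v, H.Adj u v → H.Adj v u := fun _ _ h => h.symm
  have hirr := fun v => H.irrefl (v := v)
  by_contra! hcon
  obtain ⟨y, hy, hyx⟩ := hcon a₁ sa₁ hxa₁
  obtain ⟨z, hz, hzx⟩ := hcon a₂ sa₂ hxa₂
  have hyz : y ≠ z := by
    rintro rfl
    exact hH.not_two_of_independent (fun v => s v ∧ v ≠ x) (by grind) hyx hy.symm hz.symm hxa₁ hxa₂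
      ha ha ⟨sa₁, hxa₁.ne'⟩ ⟨sa₂, hxa₂.ne'⟩ ⟨sa₁, hxa₁.ne'⟩ ⟨sa₂, hxa₂.ne'⟩
  exact hH.bichromatic a₁ a₂ x y x z ha hxa₁.symm hy hxa₂.symm hz hyx.symm hzx.symm hzx.symm hyx
    (hirr x) (by grind)

/-- If `H` becomes bipartite after removing `x`, and `x` has neighbours on both sides, then `H` is a
pentagon. -/
theorem exists_pentagon (hH : IsRainbowExtremal H) (s : V → Prop) {x : V}
    (hs : ∀ u v, H.Adj u v → (s u ↔ ¬ s v) ∨ u = x ∨ v = x)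
    [Nontrivial V] {a b : V} (hxa : H.Adj x a) (sa : s a)
    (hxb : H.Adj x b) (sb : ¬ s b) : ∃ x b c d a, IsPentagon H x b c d a := by
  by_cases ha : ∀ t, H.Adj x t → s t → t = a
  · exact exists_pentagon_of_unique hH s hs hxa sa hxb sb ha
  by_cases hb : ∀ t, H.Adj x t → ¬ s t → t = b
  · exact exists_pentagon_of_unique hH (fun v => ¬ s v) (by grind) hxb sb hxa (by grind) hb
  push Not at ha hb
  obtain ⟨a', hxa', sa', ha'⟩ := ha
  obtain ⟨b', hxb', sb', hb'⟩ := hb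
  obtain ⟨v, sv, hxv, hv⟩ := exists_pendant hH s hs ha'.symm hxa hxa' sa sa'
  obtain ⟨w, sw, hxw, hw⟩ := exists_pendant hH (fun v => ¬ s v) (by grind) hb'.symm hxb
    hxb' sb sb'
  obtain ⟨t, htx, htw⟩ := hH.exists_common_neighbor hxw hxv.ne' (by grind) hv
  exact absurd (hw t htw.symm) htx.ne

end IsRainbowExtremal

theorem stmt_4 {V : Type*} [Fintype V] (G : SimpleGraph V) (n : ℕ)
    (hcard : Fintype.card V = n)
    (hnc : ¬ Nonempty (G ≃g SimpleGraph.cycleGraph 5))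
    (h4 : riNumber G 2 = 4) :
    riNumber Gᶜ 2 ≤ n - 2 := by
  subst hcard
  by_contra hc
  have hH := isRainbowExtremal_compl G h4.ge hc
  have : Nontrivial V := by
    rw [← Fintype.one_lt_card_iff_nontrivial]
    have := riNumber_two_le_card G
    omega
  obtain ⟨P, Q, -, -, hP, hQ, hPQ, hdom⟩ :=
    exists_dominating_extension Gᶜ ∅ ∅ (by simp) (by simp) (by simp)
  have huniq : ∀ p q, p ∉ P ∪ Q → q ∉ P ∪ Q → p = q := by
    intro p q hp hq
    by_contra hpq
    exact hc (riNumber_two_le_card_sub_two Gᶜ P Q hP hQ hPQ hdom hpq hp hq)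
  simp only [Finset.mem_union] at huniq
  by_cases hx : ∃ x, x ∉ P ∧ x ∉ Q
  · obtain ⟨x, hxP, hxQ⟩ := hx
    obtain ⟨⟨a, haP, hxa⟩, ⟨b, hbQ, hxb⟩⟩ := hdom x hxP hxQ
    obtain ⟨x, b, c, d, a, h⟩ := hH.exists_pentagon (fun v => v ∈ P) (x := x) (by grind) hxa haP hxb
      (by grind)
    exact hnc h.nonempty_compl_iso
  · exact hH.not_bipartite (fun v => v ∈ P) (by grind)
end

section
/- Let G be a graph of order n with γ_ri2(G) ≥ 4 and γ_ri2(G) + γ_ri2(Ḡ) = n + 3, where Ḡ is the complement of G, and let f be a 2RiDF of G of minimum weight with colour classes V_0, V_1, V_2 (V_j = f^{-1}(j)). If |V_0| ≥ 2, then for any two distinct vertices u, v ∈ V_0 there do not exist vertices u_1, u_2, v_1, v_2 with u_1 ≠ u_2 and v_1 ≠ v_2 (possibly u_i = v_i) such that u_1, u_2 are neighbors of u in Ḡ, v_1, v_2 are neighbors of v in Ḡ, and u_1v_1 ∉ E(Ḡ) and u_2v_2 ∉ E(Ḡ). -/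
open scoped Classical

namespace RainbowNordhausGaddum

variable {V : Type*} {H : SimpleGraph V}

/-- Every proper partial labelling extends to a 2-rainbow independent dominating function. -/
theorem exists_isKRiDF_of_partial [Fintype V] (H : SimpleGraph V) (m : ℕ) : ∀ g : V → ℕ,
    (Finset.univ.filter fun v => g v = 0).card = m → (∀ v, g v ≤ 2) →
    (∀ u v, H.Adj u v → g u = g v → g u = 0) →
    ∃ f, IsKRiDF H 2 f ∧ ∀ v, g v ≠ 0 → f v = g v := by
  induction m using Nat.strong_induction_on with
  | _ m ih =>
    intro g hm hle hind
    by_cases hdom : ∀ v, g v = 0 → ∀ i, 1 ≤ i → i ≤ 2 → ∃ u, H.Adj v u ∧ g u = i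
    · refine ⟨g, ⟨hle, ?_, hdom⟩, fun _ _ => rfl⟩
      intro i hi _ u v hu hv huv
      have := hind u v huv (hu.trans hv.symm)
      omega
    · push Not at hdom
      obtain ⟨v, hv, i, hi1, hi2, hno⟩ := hdom
      have hlt : (Finset.univ.filter fun x => Function.update g v i x = 0).card < m := by
        rw [← hm]
        apply Finset.card_lt_card
        rw [Finset.ssubset_iff_of_subset]
        · exact ⟨v, by simpa using hv, by simp; omega⟩
        · intro x
          by_cases hx : x = v
          · subst hx; simpa using fun _ => hv
          · simp [hx]
      obtain ⟨f, hf, hfg⟩ := ih _ hlt (Function.update g v i) rfl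
        (by intro x
            by_cases hx : x = v
            · subst hx; simpa using hi2
            · simpa [hx] using hle x)
        (by intro x y hxy
            by_cases hx : x = v <;> by_cases hy : y = v
            · subst hx hy; exact absurd hxy (H.irrefl)
            · subst hx
              have := hno y hxy
              simp [hy]; intro h; exact absurd h.symm this
            · subst hy
              have := hno x hxy.symm
              simp [hx]; intro h; exact absurd h this
            · simpa [hx, hy] using hind x y hxy)
      refine ⟨f, hf, fun x hx => ?_⟩
      have hxv : x ≠ v := fun h => hx (h ▸ hv)
      have := hfg x (by simpa [hxv] using hx)
      simpa [hxv] using this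

/-- Two disjoint independent sets extend to the colour classes of a 2-rainbow independent
dominating function. -/
theorem exists_isKRiDF_of_sets [Fintype V] (H : SimpleGraph V) (A B : Set V)
    (hA : ∀ x ∈ A, ∀ y ∈ A, ¬ H.Adj x y) (hB : ∀ x ∈ B, ∀ y ∈ B, ¬ H.Adj x y)
    (hAB : ∀ x ∈ A, x ∉ B) :
    ∃ f, IsKRiDF H 2 f ∧ (∀ x ∈ A, f x = 1) ∧ ∀ x ∈ B, f x = 2 := by
  obtain ⟨f, hf, h⟩ := exists_isKRiDF_of_partial H _
    (fun x => if x ∈ A then 1 else if x ∈ B then 2 else 0) rfl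
    (by intro x; split_ifs <;> omega)
    (by intro x y hxy
        have h1 := fun hx hy => hA x hx y hy hxy
        have h2 := fun hx hy => hB x hx y hy hxy
        split_ifs <;> simp_all)
  refine ⟨f, hf, fun x hx => ?_, fun x hx => ?_⟩
  · simpa [hx] using h x (by simp [hx])
  · have hxA : x ∉ A := fun h => hAB x h hx
    simpa [hx, hxA] using h x (by simp [hx, hxA])

theorem IsKRiDF.not_adj {α : V → ℕ} (h : IsKRiDF H 2 α) {x y : V} (hx : α x ≠ 0)
    (hxy : α x = α y) : ¬ H.Adj x y :=
  h.2.1 (α x) (by omega) (h.1 x) x y rfl hxy.symm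

theorem IsKRiDF.adj_of_compl {β : V → ℕ} (h : IsKRiDF Hᶜ 2 β) {x y : V} (hx : β x ≠ 0)
    (hxy : β x = β y) (hne : x ≠ y) : H.Adj x y := by
  by_contra hn
  exact IsKRiDF.not_adj h hx hxy ((SimpleGraph.compl_adj _ _ _).2 ⟨hne, hn⟩)

theorem IsKRiDF.eq_zero {α : V → ℕ} (h : IsKRiDF H 2 α) {z p q : V} (hp : H.Adj z p)
    (hq : H.Adj z q) (h1 : α p = 1) (h2 : α q = 2) : α z = 0 := by
  by_contra hz
  have hle := h.1 z
  have a1 : α z ≠ α p := fun e => IsKRiDF.not_adj h hz e hp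
  have a2 : α z ≠ α q := fun e => IsKRiDF.not_adj h hz e hq
  omega

/-- The sum of the 2-rainbow independent domination numbers of `H` and its complement is
at least the order plus three. -/
def Tight [Fintype V] (H : SimpleGraph V) : Prop :=
  ∀ α β, IsKRiDF H 2 α → IsKRiDF Hᶜ 2 β → Fintype.card V + 3 ≤ riWeight α + riWeight β

theorem Tight.compl [Fintype V] (h : Tight H) : Tight Hᶜ := by
  intro α β hα hβ
  rw [compl_compl] at hβ
  have := h β α hβ hα
  omega

theorem Tight.common_zero [Fintype V] (h : Tight H) {α β : V → ℕ} (hα : IsKRiDF H 2 α)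
    (hβ : IsKRiDF Hᶜ 2 β) {z : V} (hz : α z = 0) (hz' : β z = 0) :
    (∀ x, α x = 0 → β x = 0 → x = z) ∧
      ∀ i j, 1 ≤ i → i ≤ 2 → 1 ≤ j → j ≤ 2 → ∃ x, α x = i ∧ β x = j := by
  set A := Finset.univ.filter fun x => α x ≠ 0 with hA
  set B := Finset.univ.filter fun x => β x ≠ 0 with hB
  set T : Finset (ℕ × ℕ) := Finset.Icc 1 2 ×ˢ Finset.Icc 1 2 with hT
  have hTc : T.card = 4 := by decide
  have hsum : Fintype.card V + 3 ≤ A.card + B.card := h α β hα hβ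
  have hui := Finset.card_union_add_card_inter A B
  have hsub : (A ∩ B).image (fun x => (α x, β x)) ⊆ T := by
    intro p hp
    obtain ⟨x, hx, rfl⟩ := Finset.mem_image.1 hp
    have h1 := hα.1 x
    have h2 := hβ.1 x
    simp [hA, hB, hT] at hx ⊢
    omega
  have hinj : ((A ∩ B).image (fun x => (α x, β x))).card = (A ∩ B).card := by
    apply Finset.card_image_of_injOn
    intro x hx y hy hxy
    simp [hA, hB] at hx hy hxy
    by_contra hne
    exact IsKRiDF.not_adj hα hx.1 hxy.1 (IsKRiDF.adj_of_compl hβ hx.2 hxy.2 hne)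
  have hle := Finset.card_le_card hsub
  constructor
  · intro x hx hx'
    by_contra hne
    have h2 : A ∪ B ⊆ (Finset.univ.erase x).erase z := by
      intro y hy
      simp [hA, hB] at hy ⊢
      refine ⟨?_, ?_⟩ <;> rintro rfl <;> simp_all
    have h3 := Finset.card_le_card h2
    rw [Finset.card_erase_of_mem (by simpa using Ne.symm hne),
      Finset.card_erase_of_mem (Finset.mem_univ _), Finset.card_univ] at h3
    have : 1 < Fintype.card V := Fintype.one_lt_card_iff.2 ⟨x, z, hne⟩
    omega
  · intro i j hi hi' hj hj'
    have h2 : A ∪ B ⊆ Finset.univ.erase z := by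
      intro y hy
      simp [hA, hB] at hy ⊢
      rintro rfl
      simp_all
    have h3 := Finset.card_le_card h2
    rw [Finset.card_erase_of_mem (Finset.mem_univ _), Finset.card_univ] at h3
    have : 0 < Fintype.card V := Fintype.card_pos_iff.2 ⟨z⟩
    have heq := Finset.eq_of_subset_of_card_le hsub (by omega)
    have hmem : (i, j) ∈ T := by simp [hT]; omega
    rw [← heq] at hmem
    obtain ⟨x, -, hx⟩ := Finset.mem_image.1 hmem
    simp only [Prod.mk.injEq] at hx
    exact ⟨x, hx⟩

/-- `c` enumerates an induced five-cycle of `H`. -/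
structure IsC5 (H : SimpleGraph V) (c : Fin 5 → V) : Prop where
  inj : Function.Injective c
  adj : ∀ i j, H.Adj (c i) (c j) ↔ (j = i + 1 ∨ i = j + 1)

variable {c : Fin 5 → V}

theorem IsC5.compl (h : IsC5 H c) : IsC5 Hᶜ (fun i => c (2 * i)) where
  inj := fun i j hij => by
    have := h.inj hij
    clear * - this; decide +revert
  adj := fun i j => by
    rw [SimpleGraph.compl_adj, h.adj, Ne, h.inj.eq_iff]
    clear * -; decide +revert

/-- A vertex outside the cycle whose only possible neighbour on the cycle is `c j`. -/
structure Sparse (H : SimpleGraph V) (c : Fin 5 → V) (t : V) (j : Fin 5) : Prop where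
  out : ∀ i, t ≠ c i
  eq : ∀ i, H.Adj t (c i) → i = j

/-- `α` is a 2-rainbow independent dominating function alternating along the path
obtained from the cycle by deleting `c z`. -/
structure Alternating (H : SimpleGraph V) (c : Fin 5 → V) (z : Fin 5) (α : V → ℕ) : Prop where
  ridf : IsKRiDF H 2 α
  one : α (c (z + 1)) = 1
  three : α (c (z + 3)) = 1
  two : α (c (z + 2)) = 2
  four : α (c (z + 4)) = 2

theorem Alternating.zero (hc : IsC5 H c) {z : Fin 5} {α : V → ℕ} (h : Alternating H c z α) :
    α (c z) = 0 :=
  IsKRiDF.eq_zero h.ridf ((hc.adj _ _).2 (by clear * -; decide +revert))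
    ((hc.adj _ _).2 (by clear * -; decide +revert)) h.one h.four

theorem IsC5.exists_alternating [Fintype V] (hc : IsC5 H c) (z : Fin 5) :
    ∃ α, Alternating H c z α := by
  obtain ⟨α, hα, h1, h2⟩ := exists_isKRiDF_of_sets H {c (z + 1), c (z + 3)} {c (z + 2), c (z + 4)}
    (by simp [hc.adj]; clear * -; decide +revert) (by simp [hc.adj]; clear * -; decide +revert)
    (by simp [hc.inj.eq_iff])
  exact ⟨α, hα, h1 _ (by simp), h1 _ (by simp), h2 _ (by simp), h2 _ (by simp)⟩

/-- A labelling of the complement whose classes contain two disjoint edges of the path obtained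
from the cycle by deleting `c z`. -/
theorem IsC5.exists_compl [Fintype V] (hc : IsC5 H c) (z : Fin 5) :
    ∃ β, IsKRiDF Hᶜ 2 β ∧ β (c z) = 0 ∧
    β (c (z + 1)) = 1 ∧ β (c (z + 2)) = 1 ∧ β (c (z + 3)) = 2 ∧ β (c (z + 4)) = 2 := by
  obtain ⟨β, hβ, h1, h2⟩ := exists_isKRiDF_of_sets Hᶜ {c (z + 1), c (z + 2)}
    {c (z + 3), c (z + 4)}
    (by simp [hc.adj, hc.inj.eq_iff]; clear * -; decide +revert)
    (by simp [hc.adj, hc.inj.eq_iff]; clear * -; decide +revert)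
    (by simp [hc.inj.eq_iff])
  refine ⟨β, hβ, ?_, h1 _ (by simp), h1 _ (by simp), h2 _ (by simp), h2 _ (by simp)⟩
  refine IsKRiDF.eq_zero hβ (p := c (z + 2)) (q := c (z + 3)) ?_ ?_
    (h1 _ (by simp)) (h2 _ (by simp))
  · rw [SimpleGraph.compl_adj, hc.adj, Ne, hc.inj.eq_iff]; clear * -; decide +revert
  · rw [SimpleGraph.compl_adj, hc.adj, Ne, hc.inj.eq_iff]; clear * -; decide +revert

theorem Alternating.not_adj {z : Fin 5} {α : V → ℕ} (h : Alternating H c z α) {t : V}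
    (ht : α t ≠ 0) : (¬ H.Adj t (c (z + 1)) ∧ ¬ H.Adj t (c (z + 3))) ∨
      (¬ H.Adj t (c (z + 2)) ∧ ¬ H.Adj t (c (z + 4))) := by
  have hle := h.ridf.1 t
  have : α t = 1 ∨ α t = 2 := by omega
  rcases this with e | e
  · exact .inl ⟨IsKRiDF.not_adj h.ridf ht (e.trans h.one.symm),
      IsKRiDF.not_adj h.ridf ht (e.trans h.three.symm)⟩
  · exact .inr ⟨IsKRiDF.not_adj h.ridf ht (e.trans h.two.symm),
      IsKRiDF.not_adj h.ridf ht (e.trans h.four.symm)⟩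

theorem Alternating.ne_zero_or_adj [Fintype V] (hT : Tight H) (hc : IsC5 H c) {z : Fin 5}
    {α : V → ℕ} (h : Alternating H c z α) {t : V} (ht : ∀ i, t ≠ c i) :
    α t ≠ 0 ∨ (H.Adj t (c (z + 1)) ∧ H.Adj t (c (z + 2))) ∨
      (H.Adj t (c (z + 3)) ∧ H.Adj t (c (z + 4))) := by
  by_cases h0 : α t = 0
  · right
    obtain ⟨β, hβ, hz, b1, b2, b3, b4⟩ := hc.exists_compl z
    have hne : β t ≠ 0 := fun e =>
      ht z ((hT.common_zero h.ridf hβ (Alternating.zero hc h) hz).1 t h0 e)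
    have hle := hβ.1 t
    have : β t = 1 ∨ β t = 2 := by omega
    rcases this with e | e
    · exact .inl ⟨IsKRiDF.adj_of_compl hβ hne (e.trans b1.symm) (ht _),
        IsKRiDF.adj_of_compl hβ hne (e.trans b2.symm) (ht _)⟩
    · exact .inr ⟨IsKRiDF.adj_of_compl hβ hne (e.trans b3.symm) (ht _),
        IsKRiDF.adj_of_compl hβ hne (e.trans b4.symm) (ht _)⟩
  · exact .inl h0

theorem Sparse.ne_zero [Fintype V] (hT : Tight H) (hc : IsC5 H c) {z j : Fin 5} {α : V → ℕ} {t : V}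
    (ht : Sparse H c t j) (h : Alternating H c z α) : α t ≠ 0 := by
  rcases Alternating.ne_zero_or_adj hT hc h ht.out with h | ⟨h1, h2⟩ | ⟨h1, h2⟩
  · exact h
  · have := (ht.eq _ h1).trans (ht.eq _ h2).symm
    simp at this
  · have := (ht.eq _ h1).trans (ht.eq _ h2).symm
    simp at this

theorem exists_forall_eq_of_cycle : ∀ N : Fin 5 → Bool,
    (∀ z, (N (z + 1) = false ∧ N (z + 3) = false) ∨ (N (z + 2) = false ∧ N (z + 4) = false) ∨
      (N (z + 1) = true ∧ N (z + 2) = true) ∨ (N (z + 3) = true ∧ N (z + 4) = true)) →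
    (∃ j, ∀ i, N i = true → i = j) ∨ ∃ j, ∀ i, N i = false → i = j := by
  decide

theorem IsC5.sparse_or_dense [Fintype V] (hT : Tight H) (hc : IsC5 H c) {t : V}
    (ht : ∀ i, t ≠ c i) : (∃ j, Sparse H c t j) ∨ ∃ j, ∀ i, ¬ H.Adj t (c i) → i = j := by
  have := exists_forall_eq_of_cycle (fun i => decide (H.Adj t (c i))) (by
    intro z
    simp only [decide_eq_true_eq, decide_eq_false_iff_not]
    obtain ⟨α, hα⟩ := hc.exists_alternating z
    rcases Alternating.ne_zero_or_adj hT hc hα ht with h | h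
    · rcases hα.not_adj h with h | h
      · exact .inl h
      · exact .inr (.inl h)
    · exact .inr (.inr h))
  simp only [decide_eq_true_eq, decide_eq_false_iff_not] at this
  rcases this with ⟨j, hj⟩ | h
  · exact .inl ⟨j, ht, hj⟩
  · exact .inr h

theorem Alternating.sparse_of_ne_zero [Fintype V] (hT : Tight H) (hc : IsC5 H c) {z : Fin 5}
    {α : V → ℕ} (h : Alternating H c z α) {t : V} (ht : ∀ i, t ≠ c i) (h0 : α t ≠ 0) :
    ∃ j, Sparse H c t j := by
  rcases hc.sparse_or_dense hT ht with hs | ⟨j, hj⟩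
  · exact hs
  · rcases h.not_adj h0 with ⟨h1, h2⟩ | ⟨h1, h2⟩
    · have := (hj _ h1).trans (hj _ h2).symm
      simp at this
    · have := (hj _ h1).trans (hj _ h2).symm
      simp at this

theorem Sparse.exists_adj_sparse [Fintype V] (hT : Tight H) (hc : IsC5 H c) {t : V} {j : Fin 5}
    (ht : Sparse H c t j) : ∃ s k, Sparse H c s k ∧ H.Adj t s := by
  obtain ⟨β, hβ, b1, b2⟩ := exists_isKRiDF_of_sets Hᶜ {t} {c j, c (j + 1)}
    (by simp) (by simp [hc.adj]) (by simp [ht.out])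
  have bt : β t = 1 := b1 _ (by simp)
  have bj : β (c j) = 2 := b2 _ (by simp)
  have bj' : β (c (j + 1)) = 2 := b2 _ (by simp)
  have adj_t : ∀ i, i ≠ j → Hᶜ.Adj (c i) t := fun i hi => by
    rw [SimpleGraph.compl_adj]
    exact ⟨(ht.out i).symm, fun h => hi (ht.eq i h.symm)⟩
  have z2 : β (c (j + 2)) = 0 := IsKRiDF.eq_zero hβ (adj_t _ (by simp)) (by
    rw [SimpleGraph.compl_adj, hc.adj, Ne, hc.inj.eq_iff]; clear * -; decide +revert) bt bj
  have z3 : β (c (j + 3)) = 0 := IsKRiDF.eq_zero hβ (adj_t _ (by simp)) (by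
    rw [SimpleGraph.compl_adj, hc.adj, Ne, hc.inj.eq_iff]; clear * -; decide +revert) bt bj
  have z4 : β (c (j + 4)) = 0 := IsKRiDF.eq_zero hβ (adj_t _ (by simp)) (by
    rw [SimpleGraph.compl_adj, hc.adj, Ne, hc.inj.eq_iff]; clear * -; decide +revert) bt bj'
  obtain ⟨α, hα⟩ := hc.exists_alternating (j + 2)
  have hle := hα.ridf.1 t
  have hne := Sparse.ne_zero hT hc ht hα
  obtain ⟨s, hs1, hs2⟩ := (hT.common_zero hα.ridf hβ (Alternating.zero hc hα) z2).2
    (3 - α t) 1 (by omega) (by omega) le_rfl (by omega)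
  have hcyc : ∀ i, β (c i) ≠ 1 := by
    intro i
    have : i = j ∨ i = j + 1 ∨ i = j + 2 ∨ i = j + 3 ∨ i = j + 4 := by clear * -; decide +revert
    rcases this with rfl | rfl | rfl | rfl | rfl <;> omega
  have hst : t ≠ s := by rintro rfl; omega
  obtain ⟨k, hk⟩ := Alternating.sparse_of_ne_zero hT hc hα (t := s)
    (fun i h => hcyc i (h ▸ hs2)) (by omega)
  exact ⟨s, k, hk, IsKRiDF.adj_of_compl hβ (by omega) (bt.trans hs2.symm) hst⟩

theorem Sparse.eq_of_adj [Fintype V] (hT : Tight H) (hc : IsC5 H c) {t s y : V} {i j : Fin 5}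
    (ht : Sparse H c t j) (hs : Sparse H c s i) (hts : H.Adj t s) (hty : H.Adj t y)
    (hys : y ≠ s) (hy : (∃ k, y = c k) ∨ ∃ k, Sparse H c y k) : y = c i := by
  by_contra hyi
  have hs' : ∀ m, m ≠ i → ¬ H.Adj s (c m) := fun m hm h => hm (hs.eq m h)
  have s1 := hs' (i + 1) (by simp)
  have s2 := hs' (i + 2) (by simp)
  have s3 := hs' (i + 3) (by simp)
  have s4 := hs' (i + 4) (by simp)
  have key : ((¬ H.Adj y (c (i + 1)) ∧ ¬ H.Adj y (c (i + 3))) ∧ y ≠ c (i + 2) ∧ y ≠ c (i + 4)) ∨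
      ((¬ H.Adj y (c (i + 2)) ∧ ¬ H.Adj y (c (i + 4))) ∧ y ≠ c (i + 1) ∧ y ≠ c (i + 3)) := by
    rcases hy with ⟨k, rfl⟩ | ⟨k, hk⟩
    · rw [hc.inj.eq_iff] at hyi
      simp only [hc.adj, Ne, hc.inj.eq_iff]
      clear * - hyi; decide +revert
    · have hk' : ∀ m, m ≠ k → ¬ H.Adj y (c m) := fun m hm h => hm (hk.eq m h)
      have : (i + 1 ≠ k ∧ i + 3 ≠ k) ∨ (i + 2 ≠ k ∧ i + 4 ≠ k) := by
        clear * -; decide +revert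
      rcases this with ⟨h1, h2⟩ | ⟨h1, h2⟩
      · exact .inl ⟨⟨hk' _ h1, hk' _ h2⟩, hk.out _, hk.out _⟩
      · exact .inr ⟨⟨hk' _ h1, hk' _ h2⟩, hk.out _, hk.out _⟩
  have a13 : ¬ H.Adj (c (i + 1)) (c (i + 3)) := by rw [hc.adj]; clear * -; decide +revert
  have a24 : ¬ H.Adj (c (i + 2)) (c (i + 4)) := by rw [hc.adj]; clear * -; decide +revert
  rcases key with ⟨⟨k1, k2⟩, k3, k4⟩ | ⟨⟨k1, k2⟩, k3, k4⟩
  · obtain ⟨α, hα, h1, h2⟩ := exists_isKRiDF_of_sets H {c (i + 1), c (i + 3), y}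
      {c (i + 2), c (i + 4), s}
      (by simp [k1, k2, a13, H.adj_comm _ y, H.adj_comm (c (i + 3)) (c (i + 1))])
      (by simp [s2, s4, a24, H.adj_comm _ s, H.adj_comm (c (i + 4)) (c (i + 2))])
      (by simp [hc.inj.eq_iff, k3, k4, hys, fun m => (hs.out m).symm])
    exact Sparse.ne_zero hT hc ht (α := α) (z := i) ⟨hα, h1 _ (by simp), h1 _ (by simp),
      h2 _ (by simp), h2 _ (by simp)⟩
      (IsKRiDF.eq_zero hα hty hts (h1 _ (by simp)) (h2 _ (by simp)))
  · obtain ⟨α, hα, h1, h2⟩ := exists_isKRiDF_of_sets H {c (i + 1), c (i + 3), s}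
      {c (i + 2), c (i + 4), y}
      (by simp [s1, s3, a13, H.adj_comm _ s, H.adj_comm (c (i + 3)) (c (i + 1))])
      (by simp [k1, k2, a24, H.adj_comm _ y, H.adj_comm (c (i + 4)) (c (i + 2))])
      (by simp [hc.inj.eq_iff, k3.symm, k4.symm, hys.symm, hs.out])
    exact Sparse.ne_zero hT hc ht (α := α) (z := i) ⟨hα, h1 _ (by simp), h1 _ (by simp),
      h2 _ (by simp), h2 _ (by simp)⟩
      (IsKRiDF.eq_zero hα hts hty (h1 _ (by simp)) (h2 _ (by simp)))

theorem Sparse.false [Fintype V] (hT : Tight H) (hc : IsC5 H c) {t : V} {j : Fin 5}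
    (ht : Sparse H c t j) : False := by
  obtain ⟨s, i, hs, hts⟩ := Sparse.exists_adj_sparse hT hc ht
  obtain ⟨z, hzi, hzj⟩ : ∃ z : Fin 5, z ≠ i ∧ z ≠ j := by clear * -; decide +revert
  obtain ⟨β, hβ, b1, b2⟩ := exists_isKRiDF_of_sets Hᶜ {t} {s} (by simp) (by simp)
    (by simpa using hts.ne)
  have bt : β t = 1 := b1 _ rfl
  have bs : β s = 2 := b2 _ rfl
  have bz : β (c z) = 0 := IsKRiDF.eq_zero hβ (p := t) (q := s)
    ((SimpleGraph.compl_adj _ _ _).2 ⟨(ht.out z).symm, fun h => hzj (ht.eq z h.symm)⟩)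
    ((SimpleGraph.compl_adj _ _ _).2 ⟨(hs.out z).symm, fun h => hzi (hs.eq z h.symm)⟩) bt bs
  obtain ⟨α, hα⟩ := hc.exists_alternating z
  have hall := (hT.common_zero hα.ridf hβ (Alternating.zero hc hα) bz).2
  have t0 := Sparse.ne_zero hT hc ht hα
  have s0 := Sparse.ne_zero hT hc hs hα
  have hts' : α t ≠ α s := fun e => IsKRiDF.not_adj hα.ridf t0 e hts
  have hcyc : ∀ r, α r ≠ 0 → (∃ k, r = c k) ∨ ∃ k, Sparse H c r k := by
    intro r hr
    by_cases h : ∃ k, r = c k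
    · exact .inl h
    · push Not at h
      exact .inr (Alternating.sparse_of_ne_zero hT hc hα h hr)
  obtain ⟨r, hr, hr'⟩ := hall (α s) 1 (by omega) (hα.ridf.1 s) le_rfl (by omega)
  obtain ⟨q, hq, hq'⟩ := hall (α t) 2 (by omega) (hα.ridf.1 t) (by omega) le_rfl
  have htr : H.Adj t r := IsKRiDF.adj_of_compl hβ (by omega) (bt.trans hr'.symm)
    (by rintro rfl; exact hts' hr)
  have hsq : H.Adj s q := IsKRiDF.adj_of_compl hβ (by omega) (bs.trans hq'.symm)
    (by rintro rfl; exact hts' hq.symm)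
  have er : r = c i := Sparse.eq_of_adj hT hc ht hs hts htr (by rintro rfl; omega)
    (hcyc r (by omega))
  have eq : q = c j := Sparse.eq_of_adj hT hc hs ht hts.symm hsq (by rintro rfl; omega)
    (hcyc q (by omega))
  have hij : i = j := ht.eq i (er ▸ htr)
  have : r = q := by rw [er, eq, hij]
  subst this
  omega

theorem Tight.card_le_five_of_isC5 [Fintype V] (hT : Tight H) (hc : IsC5 H c) :
    Fintype.card V ≤ 5 := by
  by_contra hcard
  obtain ⟨t, ht⟩ : ∃ t, ∀ i, t ≠ c i := by
    by_contra hno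
    push Not at hno
    have := Fintype.card_le_of_surjective c (fun t => (hno t).imp fun _ h => h.symm)
    simp at this
    omega
  rcases hc.sparse_or_dense hT ht with ⟨j, hj⟩ | ⟨j, hj⟩
  · exact Sparse.false hT hc hj
  · refine Sparse.false hT.compl hc.compl (t := t) (j := 3 * j) ⟨fun i => ht _, fun i h => ?_⟩
    have := hj _ ((SimpleGraph.compl_adj _ _ _).1 h).2
    subst this
    clear * -; decide +revert

/-- If `β` vanishes at `u` and `v`, then no disjoint independent pairs `{u₁, v₁}`, `{u₂, v₂}`
of `H` dominate both `u` and `v`. -/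
theorem Tight.not_both_zero [Fintype V] (hT : Tight H) {β : V → ℕ} (hβ : IsKRiDF Hᶜ 2 β) {u v : V}
    (hu : β u = 0) (hv : β v = 0) (huv : u ≠ v) {u₁ u₂ v₁ v₂ : V} (hu' : u₁ ≠ u₂)
    (hv' : v₁ ≠ v₂) (h12 : u₁ ≠ v₂) (h21 : u₂ ≠ v₁) (a1 : H.Adj u u₁) (a2 : H.Adj u u₂)
    (a3 : H.Adj v v₁) (a4 : H.Adj v v₂) (n1 : ¬ H.Adj u₁ v₁) (n2 : ¬ H.Adj u₂ v₂) : False := by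
  obtain ⟨α, hα, h1, h2⟩ := exists_isKRiDF_of_sets H {u₁, v₁} {u₂, v₂}
    (by simp [n1, H.adj_comm v₁ u₁]) (by simp [n2, H.adj_comm v₂ u₂])
    (by simp [hu', hv', h12, h21.symm])
  have zu := IsKRiDF.eq_zero hα a1 a2 (h1 _ (by simp)) (h2 _ (by simp))
  have zv := IsKRiDF.eq_zero hα a3 a4 (h1 _ (by simp)) (h2 _ (by simp))
  exact huv ((hT.common_zero hα hβ zv hv).1 u zu hu)

theorem Tight.not_common_neighbor [Fintype V] (hT : Tight H) (hcard : 5 < Fintype.card V) {β : V → ℕ}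
    (hβ : IsKRiDF Hᶜ 2 β) {u v a b c : V} (hu : β u = 0) (hv : β v = 0) (huv : u ≠ v)
    (hab : a ≠ b) (hac : a ≠ c) (ua : H.Adj u a) (ub : H.Adj u b) (va : H.Adj v a)
    (vc : H.Adj v c) (nac : ¬ H.Adj a c) (nab : ¬ H.Adj a b) : False := by
  have codeg : ∀ x, x ≠ a → H.Adj u x → H.Adj v x → False := fun x hx h1 h2 =>
    hT.not_both_zero hβ hu hv huv hx.symm hx.symm hx.symm hx ua h1 va h2 (H.irrefl) (H.irrefl)
  have nvb : ¬ H.Adj v b := fun h => codeg b hab.symm ub h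
  have nuc : ¬ H.Adj u c := fun h => codeg c hac.symm h vc
  have bc_ne : b ≠ c := by rintro rfl; exact nvb vc
  have bc : H.Adj b c := by
    by_contra h
    exact hT.not_both_zero hβ hu hv huv hab hac hac hab.symm ua ub va vc (H.irrefl) h
  have buv : b ≠ v := by rintro rfl; exact nab va.symm
  have cuu : c ≠ u := by rintro rfl; exact nac ua.symm
  by_cases huv' : H.Adj u v
  · obtain ⟨α, hα, h1, h2⟩ := exists_isKRiDF_of_sets H {a, c} {u}
      (by simp [nac, H.adj_comm c a]) (by simp) (by simp [ua.ne.symm, cuu])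
    have au : α u = 2 := h2 _ rfl
    have aa : α a = 1 := h1 _ (by simp)
    have ac : α c = 1 := h1 _ (by simp)
    have zv := IsKRiDF.eq_zero hα va huv'.symm aa au
    have zb := IsKRiDF.eq_zero hα bc ub.symm ac au
    obtain ⟨γ, hγ, g1, g2⟩ := exists_isKRiDF_of_sets Hᶜ {a} {u, v}
      (by simp) (by simp [huv', huv'.symm]) (by simp [ua.ne.symm, va.ne.symm])
    have ga : γ a = 1 := g1 _ rfl
    have gu : γ u = 2 := g2 _ (by simp)
    have gv : γ v = 2 := g2 _ (by simp)
    have gb : γ b = 0 := IsKRiDF.eq_zero hγ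
      ((SimpleGraph.compl_adj _ _ _).2 ⟨hab.symm, fun h => nab h.symm⟩)
      ((SimpleGraph.compl_adj _ _ _).2 ⟨buv, fun h => nvb h.symm⟩) ga gv
    obtain ⟨t, ht, ht'⟩ := (hT.common_zero hα hγ zb gb).2 1 2 le_rfl (by omega) (by omega) le_rfl
    refine codeg t (by rintro rfl; omega) ?_ ?_
    · exact IsKRiDF.adj_of_compl hγ (by omega) (gu.trans ht'.symm) (by rintro rfl; omega)
    · exact IsKRiDF.adj_of_compl hγ (by omega) (gv.trans ht'.symm) (by rintro rfl; omega)
  · have hC : IsC5 H ![u, a, v, c, b] := by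
      constructor
      · intro i j
        fin_cases i <;> fin_cases j <;>
          simp [ua.ne, ua.ne.symm, va.ne, va.ne.symm, huv, huv.symm, hab, hab.symm, hac, hac.symm,
            ub.ne, ub.ne.symm, vc.ne, vc.ne.symm, bc_ne, bc_ne.symm, buv, buv.symm, cuu, cuu.symm]
      · intro i j
        fin_cases i <;> fin_cases j <;>
          simp [ua, ua.symm, ub, ub.symm, va, va.symm, vc, vc.symm, bc, bc.symm, nac, nab, nvb, nuc,
            huv', H.adj_comm c a, H.adj_comm b a, H.adj_comm b v, H.adj_comm c u, H.adj_comm v u]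
    have := hT.card_le_five_of_isC5 hC
    omega

end RainbowNordhausGaddum

theorem stmt_5 {V : Type*} [Fintype V] (G : SimpleGraph V) (n : ℕ)
    (hcard : Fintype.card V = n)
    (h4 : 4 ≤ riNumber G 2)
    (hsum : riNumber G 2 + riNumber Gᶜ 2 = n + 3)
    (f : V → ℕ) (hf : IsKRiDF G 2 f) (hmin : riWeight f = riNumber G 2)
    (h0 : 2 ≤ (Finset.univ.filter fun v => f v = 0).card) :
    ∀ u v : V, f u = 0 → f v = 0 → u ≠ v →
      ¬ ∃ u₁ u₂ v₁ v₂ : V, u₁ ≠ u₂ ∧ v₁ ≠ v₂ ∧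
          Gᶜ.Adj u u₁ ∧ Gᶜ.Adj u u₂ ∧ Gᶜ.Adj v v₁ ∧ Gᶜ.Adj v v₂ ∧
          ¬ Gᶜ.Adj u₁ v₁ ∧ ¬ Gᶜ.Adj u₂ v₂ := by
  open RainbowNordhausGaddum in
  have hT : Tight Gᶜ := by
    intro α β hα hβ
    rw [compl_compl] at hβ
    have h1 : riNumber Gᶜ 2 ≤ riWeight α := Nat.sInf_le ⟨α, hα, rfl⟩
    have h2 : riNumber G 2 ≤ riWeight β := Nat.sInf_le ⟨β, hβ, rfl⟩
    omega
  have hbig : 5 < Fintype.card V := by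
    have := Finset.card_filter_add_card_filter_not (s := (Finset.univ : Finset V))
      (fun v => f v = 0)
    rw [Finset.card_univ] at this
    have hw : riWeight f = (Finset.univ.filter fun v => ¬ f v = 0).card := rfl
    omega
  have hf' : IsKRiDF Gᶜᶜ 2 f := by rwa [compl_compl]
  rintro u v hu hv huv ⟨u₁, u₂, v₁, v₂, hu', hv', a1, a2, a3, a4, n1, n2⟩
  by_cases h12 : u₁ = v₂
  · subst h12
    exact hT.not_common_neighbor hbig hf' hu hv huv hu' hv'.symm a1 a2 a4 a3 n1
      (fun h => n2 h.symm)
  by_cases h21 : u₂ = v₁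
  · subst h21
    exact hT.not_common_neighbor hbig hf' hu hv huv hu'.symm hv' a2 a1 a3 a4 n2
      (fun h => n1 h.symm)
  exact hT.not_both_zero hf' hu hv huv hu' hv' h12 h21 a1 a2 a3 a4 n1 n2
end
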